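/- arXiv:1808.10074 — 2 statements merged into one kernel-verified Lean document; each statement's English description precedes it below -/
import Mathlib

section
/- Let m ≥ 4 and p ≥ 7 be integers and let G be a finite simple graph whose vertex set is partitioned into p parts V_1, …, V_p, each of size q, such that: (i) each induced subgraph G[V_i] is m-regular and m-connected; (ii) every vertex of V_i has exactly two neighbours of G outside V_i ('outside neighbours'), and these two outside neighbours lie in two distinct parts other than V_i; (iii) for any two distinct parts V_i and V_j the number of edges of G between V_i and V_j equals 2q/(p−1), and 2q/(p−1) ≥ m + 2. Let S = {v_1, v_2, v_3} be a set of three distinct vertices all lying in one part V_i. If there exist m − 1 edge-disjoint trees T_1, …, T_{m−1} in G[V_i] each containing S with V(T_a) ∩ V(T_b) = S for all a ≠ b, then there exist m + 1 edge-disjoint trees T_1, …, T_{m+1} in G each containing S with V(T_a) ∩ V(T_b) = S for all a ≠ b. -/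
/-- A graph `G` is `k`-connected if it has more than `k` vertices and removing any set of
fewer than `k` vertices leaves a connected graph (equivalently, `κ(G) ≥ k`). -/
def IsKConnected {V : Type*} [Fintype V] (k : ℕ) (G : SimpleGraph V) : Prop :=
  k < Fintype.card V ∧ ∀ D : Set V, D.ncard < k → (G.induce Dᶜ).Connected

/-- There exist `r` internally disjoint trees connecting `S` in `G`: `r` pairwise
edge-disjoint trees `T₁, …, T_r` of `G`, each containing `S`, with
`V(T_a) ∩ V(T_b) = S` for all `a ≠ b`. -/
def ConnectsSet {V : Type*} (G : SimpleGraph V) (S : Set V) (r : ℕ) : Prop :=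
  ∃ T : Fin r → G.Subgraph,
    (∀ a, (T a).coe.IsTree) ∧
    (∀ a, S ⊆ (T a).verts) ∧
    (∀ a b, a ≠ b → (T a).verts ∩ (T b).verts = S) ∧
    (∀ a b, a ≠ b → Disjoint (T a).edgeSet (T b).edgeSet)

namespace SimpleGraph

variable {V : Type*} {G : SimpleGraph V}

/-- A connected induced subgraph has an edge crossing any cut of its vertex set. -/
lemma Connected.exists_adj_crossing {s : Set V} (h : (G.induce s).Connected) (C : Set V)
    {x y : V} (hxs : x ∈ s) (hx : x ∈ C) (hys : y ∈ s) (hy : y ∉ C) :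
    ∃ u ∈ s, u ∈ C ∧ ∃ w ∈ s, w ∉ C ∧ G.Adj u w := by
  obtain ⟨p⟩ := h.preconnected ⟨x, hxs⟩ ⟨y, hys⟩
  obtain ⟨d, -, h1, h2⟩ := p.exists_boundary_dart {z | z.1 ∈ C} hx hy
  exact ⟨d.fst, d.fst.2, h1, d.snd, d.snd.2, h2, d.adj⟩

lemma Connected.induce_union_of_adj {s t : Set V} (hs : (G.induce s).Connected)
    (ht : (G.induce t).Connected) {u w : V} (hu : u ∈ s) (hw : w ∈ t) (h : G.Adj u w) :
    (G.induce (s ∪ t)).Connected :=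
  connected_induce_union hs.preconnected ht.preconnected hu hw h

lemma connected_induce_singleton (v : V) : (G.induce {v}).Connected := by
  have : Nonempty ({v} : Set V) := ⟨⟨v, rfl⟩⟩
  exact ⟨Preconnected.of_subsingleton⟩

lemma Connected.induce_insert {s : Set V} (hs : (G.induce s).Connected) {u w : V} (hu : u ∈ s)
    (h : G.Adj u w) : (G.induce (insert w s)).Connected := by
  rw [Set.insert_eq, Set.union_comm]
  exact hs.induce_union_of_adj (connected_induce_singleton w) hu rfl h

/-- If `Z` induces a 2-connected graph and `C ∋ s`, `Z \ C ∋ t` both induce connected graphs, then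
some vertex other than `t` can be moved from `Z \ C` to `C` keeping both sides connected. -/
lemma exists_connected_insert_diff [Finite V] {Z C : Set V}
    (hZ : ∀ v ∈ Z, (G.induce (Z \ {v})).Connected) {s t e : V} (hCZ : C ⊆ Z)
    (hs : s ∈ C) (ht : t ∈ Z \ C) (he : e ∈ Z \ C) (het : e ≠ t)
    (hC : (G.induce C).Connected) (hD : (G.induce (Z \ C)).Connected) :
    ∃ v ∈ Z \ C, v ≠ t ∧ (G.induce (insert v C)).Connected ∧
      (G.induce (Z \ insert v C)).Connected := by
  let P : Set (Set V) := {L | t ∈ L ∧ (G.induce L).Connected ∧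
    ∃ v ∈ Z \ C, (∃ c ∈ C, G.Adj c v) ∧ v ∉ L ∧ L ⊆ Z \ C}
  have hP : P.Nonempty := by
    obtain ⟨c, -, hc, v, hvZ, hv, hcv⟩ := (hZ t ht.1).exists_adj_crossing C
      (x := s) ⟨hCZ hs, fun h => ht.2 (h ▸ hs)⟩ hs (y := e) ⟨he.1, het⟩ he.2
    exact ⟨{t}, rfl, connected_induce_singleton t, v, ⟨hvZ.1, hv⟩, ⟨c, hc, hcv⟩, hvZ.2,
      Set.singleton_subset_iff.2 ht⟩
  obtain ⟨L, ⟨htL, hL, v, hv, ⟨c, hc, hcv⟩, hvL, hLD⟩, hmax⟩ := P.toFinite.exists_maximal hP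
  have hclosed : ∀ w ∈ Z \ C, w ≠ v → w ∉ L → ∀ u ∈ L, ¬ G.Adj u w := by
    intro w hw hwv hwL u hu huw
    exact hwL (hmax ⟨Set.mem_insert_of_mem _ htL, hL.induce_insert hu huw, v, hv, ⟨c, hc, hcv⟩,
      by simp [hvL, hwv.symm], Set.insert_subset hw hLD⟩ (Set.subset_insert w L)
      (Set.mem_insert w L))
  suffices hLeq : Z \ insert v C = L by
    exact ⟨v, hv, fun h => hvL (h ▸ htL), hC.induce_insert hc hcv, hLeq ▸ hL⟩
  by_contra hne
  obtain ⟨k, hkD, hkv, hkL⟩ : ∃ k ∈ Z \ C, k ≠ v ∧ k ∉ L := by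
    by_contra! h
    refine hne (Set.Subset.antisymm (fun x hx => ?_) fun x hx => ?_)
    · exact h x ⟨hx.1, fun h' => hx.2 (.inr h')⟩ fun h' => hx.2 (.inl h')
    · exact ⟨(hLD hx).1, fun h' => h'.elim (fun h' => hvL (h' ▸ hx)) (hLD hx).2⟩
  obtain ⟨k', hk'Z, hk', w, hwZ, hw, hkw⟩ := (hZ v hv.1).exists_adj_crossing
    ((Z \ C) \ L) (x := k) ⟨hkD.1, hkv⟩ ⟨hkD, hkL⟩ (y := s)
    ⟨hCZ hs, fun h => hv.2 (h ▸ hs)⟩ fun h => h.1.2 hs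
  have hwC : w ∈ C := by
    by_contra hwC
    have hwL : w ∈ L := by
      by_contra hwL
      exact hw ⟨⟨hwZ.1, hwC⟩, hwL⟩
    exact hclosed k' hk'.1 hk'Z.2 hk'.2 w hwL hkw.symm
  obtain ⟨u, -, hu, x, hxD, hx, hux⟩ := hD.exists_adj_crossing L ht htL hv hvL
  have hxv : x = v := by
    by_contra hxv
    exact hclosed x hxD hxv hx u hu hux
  subst hxv
  exact hx (hmax ⟨Set.mem_insert_of_mem _ htL, hL.induce_insert hu hux, k', hk'.1,
    ⟨w, hwC, hkw.symm⟩, by simpa [hk'.2] using hk'Z.2, Set.insert_subset hxD hLD⟩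
    (Set.subset_insert x L) (Set.mem_insert x L))

/-- A 2-connected induced graph splits into connected sides `C ∋ s` and `Z \ C ∋ t` such that
`C` has exactly one vertex in a prescribed set `E` meeting `Z \ {t}`. -/
lemma exists_connected_split [Finite V] {Z E : Set V}
    (hZ : ∀ v ∈ Z, (G.induce (Z \ {v})).Connected) {s t e : V} (hs : s ∈ Z) (ht : t ∈ Z)
    (hst : s ≠ t) (he : e ∈ Z) (heE : e ∈ E) (het : e ≠ t) :
    ∃ C ⊆ Z, s ∈ C ∧ t ∉ C ∧ (G.induce C).Connected ∧ (G.induce (Z \ C)).Connected ∧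
      ∃ v ∈ C, v ∈ E ∧ ∀ w ∈ C, w ∈ E → w = v := by
  by_cases hsE : s ∈ E
  · exact ⟨{s}, Set.singleton_subset_iff.2 hs, rfl, hst.symm, connected_induce_singleton s,
      hZ s hs, s, rfl, hsE, fun w hw _ => hw⟩
  let P : Set (Set V) := {C | C ⊆ Z ∧ s ∈ C ∧ t ∉ C ∧ (G.induce C).Connected ∧
    (G.induce (Z \ C)).Connected ∧ ∀ w ∈ C, w ∉ E}
  have hP : P.Nonempty := ⟨{s}, Set.singleton_subset_iff.2 hs, rfl, hst.symm,
    connected_induce_singleton s, hZ s hs, by simpa using hsE⟩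
  obtain ⟨C, ⟨hCZ, hsC, htC, hC, hD, hCE⟩, hmax⟩ := P.toFinite.exists_maximal hP
  obtain ⟨v, hv, hvt, hC', hD'⟩ := exists_connected_insert_diff hZ hCZ hsC ⟨ht, htC⟩
    ⟨he, fun h => hCE e h heE⟩ het hC hD
  have hsub : insert v C ⊆ Z := Set.insert_subset hv.1 hCZ
  have htC' : t ∉ insert v C := by simp [hvt.symm, htC]
  refine ⟨insert v C, hsub, .inr hsC, htC', hC', hD', v, .inl rfl, ?_, ?_⟩
  · by_contra hvE
    refine hv.2 (hmax ⟨hsub, .inr hsC, htC', hC', hD', ?_⟩ (Set.subset_insert v C)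
      (Set.mem_insert v C))
    rintro w (rfl | hw)
    exacts [hvE, hCE w hw]
  · rintro w (rfl | hw) hwE
    exacts [rfl, (hCE w hw hwE).elim]

/-- A set `S` whose vertices all have a neighbour in a connected region `R` is spanned, together
with `R`, by a tree all of whose edges meet `R`. -/
lemma exists_tree_through_region {S R : Set V} (hR : (G.induce R).Connected)
    (hS : ∀ v ∈ S, ∃ w ∈ R, G.Adj v w) :
    ∃ T : G.Subgraph, T.coe.IsTree ∧ T.verts = S ∪ R ∧ ∀ u v, T.Adj u v → u ∈ R ∨ v ∈ R := by
  let K : SimpleGraph (S ∪ R : Set V) :=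
    { Adj := fun u v => G.Adj u v ∧ (u.1 ∈ R ∨ v.1 ∈ R)
      symm := ⟨fun u v h => ⟨h.1.symm, h.2.symm⟩⟩
      loopless := ⟨fun u h => h.1.ne rfl⟩ }
  have hK : K.Connected := by
    obtain ⟨⟨r, hr⟩⟩ := hR.nonempty
    let f : G.induce R →g K := ⟨fun x => ⟨x.1, .inr x.2⟩, fun {a b} h => ⟨h, .inl a.2⟩⟩
    have hreach : ∀ x (hx : x ∈ R), K.Reachable ⟨r, .inr hr⟩ ⟨x, .inr hx⟩ := fun x hx =>
      (hR.preconnected ⟨r, hr⟩ ⟨x, hx⟩).map f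
    rw [connected_iff_exists_forall_reachable]
    refine ⟨⟨r, .inr hr⟩, ?_⟩
    rintro ⟨x, hx | hx⟩
    · obtain ⟨w, hw, hxw⟩ := hS x hx
      have hadj : K.Adj ⟨w, .inr hw⟩ ⟨x, .inl hx⟩ := ⟨hxw.symm, .inl hw⟩
      exact (hreach w hw).trans hadj.reachable
    · exact hreach x hx
  obtain ⟨F, hFK, hF⟩ := hK.exists_isTree_le
  let T : G.Subgraph :=
    { verts := S ∪ R
      Adj := fun u v => ∃ (hu : u ∈ S ∪ R) (hv : v ∈ S ∪ R), F.Adj ⟨u, hu⟩ ⟨v, hv⟩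
      adj_sub := by
        rintro u v ⟨hu, hv, h⟩
        exact (hFK h).1
      edge_vert := fun h => h.1
      symm := ⟨fun u v h => ⟨h.2.1, h.1, h.2.2.symm⟩⟩ }
  have hT : T.coe = F := by
    ext u v
    exact ⟨fun h => h.2.2, fun h => ⟨u.2, v.2, h⟩⟩
  exact ⟨T, hT ▸ hF, rfl, fun u v h => (hFK h.2.2).2⟩

/-- Two disjoint connected regions outside `A`, each adjacent to all of `S ⊆ A`, provide two more
internally disjoint trees connecting `S`. -/
lemma connectsSet_add_two {S A R₁ R₂ : Set V} {n : ℕ} (T : Fin n → G.Subgraph)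
    (hTA : ∀ a, (T a).verts ⊆ A) (hT : ∀ a, (T a).coe.IsTree) (hTS : ∀ a, S ⊆ (T a).verts)
    (hTv : ∀ a b, a ≠ b → (T a).verts ∩ (T b).verts = S)
    (hTe : ∀ a b, a ≠ b → Disjoint (T a).edgeSet (T b).edgeSet)
    (hSA : S ⊆ A) (hR₁ : (G.induce R₁).Connected) (hR₂ : (G.induce R₂).Connected)
    (hA₁ : Disjoint A R₁) (hA₂ : Disjoint A R₂) (h₁₂ : Disjoint R₁ R₂)
    (hS₁ : ∀ v ∈ S, ∃ w ∈ R₁, G.Adj v w) (hS₂ : ∀ v ∈ S, ∃ w ∈ R₂, G.Adj v w) :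
    ConnectsSet G S (n + 2) := by
  obtain ⟨T₁, hT₁, hv₁, he₁⟩ := exists_tree_through_region hR₁ hS₁
  obtain ⟨T₂, hT₂, hv₂, he₂⟩ := exists_tree_through_region hR₂ hS₂
  let Q : G.Subgraph → G.Subgraph → Prop := fun X Y =>
    X.verts ∩ Y.verts = S ∧ Disjoint X.edgeSet Y.edgeSet
  have hQsymm : ∀ X Y, Q X Y → Q Y X := fun X Y h => ⟨Set.inter_comm _ _ ▸ h.1, h.2.symm⟩
  have hQ : ∀ {R B : Set V} {X Y : G.Subgraph}, X.verts = S ∪ R →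
      (∀ u v, X.Adj u v → u ∈ R ∨ v ∈ R) → Disjoint R B → Y.verts ⊆ B → S ⊆ Y.verts → Q X Y := by
    intro R B X Y hX hXe hRB hYB hSY
    rw [Set.disjoint_left] at hRB
    refine ⟨?_, Set.disjoint_left.2 fun e => ?_⟩
    · rw [hX]
      ext x
      have := @hRB x
      have := @hYB x
      have := @hSY x
      simp only [Set.mem_inter_iff, Set.mem_union]
      tauto
    · induction e with
      | h u v =>
        intro hX hY
        rcases hXe u v hX with h | h
        · exact hRB h (hYB (Y.edge_vert hY))
        · exact hRB h (hYB (Y.edge_vert hY.symm))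
  have hcons : ∀ {k : ℕ} (X : G.Subgraph) (Y : Fin k → G.Subgraph), (∀ a, Q X (Y a)) →
      (∀ a b, a ≠ b → Q (Y a) (Y b)) → ∀ a b, a ≠ b →
        Q (Fin.cons (α := fun _ => G.Subgraph) X Y a)
          (Fin.cons (α := fun _ => G.Subgraph) X Y b) := by
    intro k X Y hX hY a b hab
    induction a using Fin.cases with
    | zero =>
      induction b using Fin.cases with
      | zero => exact (hab rfl).elim
      | succ b => exact hX b
    | succ a =>
      induction b using Fin.cases with
      | zero => exact hQsymm _ _ (hX a)
      | succ b => exact hY a b fun h => hab (h ▸ rfl)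
  have hQ₁ : ∀ a, Q T₁ (T a) := fun a => hQ hv₁ he₁ hA₁.symm (hTA a) (hTS a)
  have hQ₂ : ∀ a, Q T₂ (T a) := fun a => hQ hv₂ he₂ hA₂.symm (hTA a) (hTS a)
  have hSR : Disjoint R₁ (S ∪ R₂) :=
    Set.disjoint_union_right.2 ⟨(hA₁.mono_left hSA).symm, h₁₂⟩
  have hQ₁₂ : Q T₁ T₂ := hQ hv₁ he₁ hSR hv₂.subset (hv₂ ▸ Set.subset_union_left)
  have hpair := hcons T₁ (Fin.cons T₂ T) (Fin.cases hQ₁₂ hQ₁)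
    (hcons T₂ T hQ₂ fun a b hab => ⟨hTv a b hab, hTe a b hab⟩)
  refine ⟨Fin.cons T₁ (Fin.cons T₂ T), Fin.cases hT₁ (Fin.cases hT₂ hT), ?_,
    fun a b hab => (hpair a b hab).1, fun a b hab => (hpair a b hab).2⟩
  exact Fin.cases (hv₁ ▸ Set.subset_union_left) (Fin.cases (hv₂ ▸ Set.subset_union_left) hTS)

/-- A union of connected parts, any two of them joined by an edge, is connected. -/
lemma connected_induce_preimage {ι : Type*} (part : V → ι)
    (hconn : ∀ i, (G.induce {v | part v = i}).Connected)
    (hadj : ∀ i j, i ≠ j → ∃ u w, G.Adj u w ∧ part u = i ∧ part w = j)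
    {P : Set ι} (hP : P.Nonempty) : (G.induce (part ⁻¹' P)).Connected := by
  obtain ⟨i, hi⟩ := hP
  obtain ⟨⟨x, hx⟩⟩ := (hconn i).nonempty
  have hx : part x = i := hx
  refine induce_connected_of_patches x (by simpa [hx] using hi) fun {y} hy => ?_
  by_cases hxy : part y = i
  · exact ⟨{v | part v = i}, fun v (hv : part v = i) => by simpa [hv] using hi, hx, hxy,
      (hconn i).preconnected _ _⟩
  · obtain ⟨u, w, huw, hu, hw⟩ := hadj i (part y) (Ne.symm hxy)
    refine ⟨{v | part v = i} ∪ {v | part v = part y}, ?_, .inl hx, .inr rfl,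
      ((hconn i).induce_union_of_adj (hconn (part y)) hu hw huw).preconnected _ _⟩
    rintro v (hv | hv)
    · simpa [show part v = i from hv] using hi
    · simpa [show part v = part y from hv] using hy

end SimpleGraph

lemma IsKConnected.induce_diff_connected {V : Type*} [Fintype V] {G : SimpleGraph V} {k : ℕ}
    {Z : Set V} [Fintype Z] (h : IsKConnected k (G.induce Z)) {D : Set V} (hDZ : D ⊆ Z)
    (hD : D.ncard < k) : (G.induce (Z \ D)).Connected := by
  have hcard : (Subtype.val ⁻¹' D : Set Z).ncard < k := by
    rwa [Set.ncard_preimage_of_injective_subset_range Subtype.val_injective (by simpa)]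
  let f : (G.induce Z).induce (Subtype.val ⁻¹' D : Set Z)ᶜ →g G.induce (Z \ D) :=
    ⟨fun x => ⟨x.1.1, x.1.2, x.2⟩, fun h => h⟩
  exact (h.2 _ hcard).map f fun y => ⟨⟨⟨y.1, y.2.1⟩, y.2.2⟩, rfl⟩

/-- Three edges on a set either admit a proper 2-colouring or form a triangle. -/
lemma exists_coloring_or_triangle {α : Type*} {a₁ b₁ a₂ b₂ a₃ b₃ : α} (h₁ : a₁ ≠ b₁) (h₂ : a₂ ≠ b₂)
    (h₃ : a₃ ≠ b₃) :
    (∃ c : α → Prop, (¬ (c a₁ ↔ c b₁)) ∧ (¬ (c a₂ ↔ c b₂)) ∧ (¬ (c a₃ ↔ c b₃))) ∨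
    ∃ x y z : α, x ≠ y ∧ y ≠ z ∧ x ≠ z ∧ (a₁ = x ∧ b₁ = y ∨ a₁ = y ∧ b₁ = x) ∧
      (a₂ = y ∧ b₂ = z ∨ a₂ = z ∧ b₂ = y) ∧ (a₃ = z ∧ b₃ = x ∨ a₃ = x ∧ b₃ = z) := by
  have key : ∀ u v w : α,
      (¬ ((a₁ = u ∨ a₁ = v ∨ a₁ = w) ↔ (b₁ = u ∨ b₁ = v ∨ b₁ = w))) ∧
      (¬ ((a₂ = u ∨ a₂ = v ∨ a₂ = w) ↔ (b₂ = u ∨ b₂ = v ∨ b₂ = w))) ∧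
      (¬ ((a₃ = u ∨ a₃ = v ∨ a₃ = w) ↔ (b₃ = u ∨ b₃ = v ∨ b₃ = w))) →
      ∃ c : α → Prop, (¬ (c a₁ ↔ c b₁)) ∧ (¬ (c a₂ ↔ c b₂)) ∧ (¬ (c a₃ ↔ c b₃)) :=
    fun u v w h => ⟨fun x => x = u ∨ x = v ∨ x = w, h⟩
  by_contra! hcon
  have k1 := mt (key a₁ a₂ a₃) (by push Not; exact hcon.1)
  have k2 := mt (key a₁ a₂ b₃) (by push Not; exact hcon.1)
  have k3 := mt (key a₁ b₂ a₃) (by push Not; exact hcon.1)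
  have k4 := mt (key a₁ b₂ b₃) (by push Not; exact hcon.1)
  have t1 := hcon.2 a₁ b₁ a₂
  have t2 := hcon.2 a₁ b₁ b₂
  have t3 := hcon.2 b₁ a₁ a₂
  have t4 := hcon.2 b₁ a₁ b₂
  clear hcon key
  grind

/-- with the partitioned-graph set-up (with `p ≥ 7` parts), if
`S = {v₁, v₂, v₃}` consists of three distinct vertices of one part `V_i` and there are
`m - 1` internally disjoint trees connecting `S` inside `G[V_i]`, then there are `m + 1`
internally disjoint trees connecting `S` in `G`. -/
theorem stmt_3 {V : Type*} [Fintype V] (G : SimpleGraph V)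
    (p q m : ℕ) (hm : 4 ≤ m) (hp : 7 ≤ p)
    (part : V → Fin p)
    (hsize : ∀ i : Fin p, {v : V | part v = i}.ncard = q)
    (hreg : ∀ v : V, {w : V | G.Adj v w ∧ part w = part v}.ncard = m)
    (hconn : ∀ i : Fin p, IsKConnected m (G.induce {v : V | part v = i}))
    (hout : ∀ v : V, ∃ w₁ w₂ : V, w₁ ≠ w₂ ∧ G.Adj v w₁ ∧ G.Adj v w₂ ∧
      part w₁ ≠ part v ∧ part w₂ ≠ part v ∧ part w₁ ≠ part w₂ ∧
      (∀ w : V, G.Adj v w → part w ≠ part v → w = w₁ ∨ w = w₂))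
    (hcross : ∀ i j : Fin p, i ≠ j →
      {e : V × V | G.Adj e.1 e.2 ∧ part e.1 = i ∧ part e.2 = j}.ncard * (p - 1) = 2 * q ∧
      m + 2 ≤ {e : V × V | G.Adj e.1 e.2 ∧ part e.1 = i ∧ part e.2 = j}.ncard)
    (i : Fin p) (v₁ v₂ v₃ : V)
    (h12 : v₁ ≠ v₂) (h13 : v₁ ≠ v₃) (h23 : v₂ ≠ v₃)
    (hv₁ : part v₁ = i) (hv₂ : part v₂ = i) (hv₃ : part v₃ = i)
    (htrees : ∃ T : Fin (m - 1) → G.Subgraph,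
      (∀ a, (T a).verts ⊆ {v : V | part v = i}) ∧
      (∀ a, (T a).coe.IsTree) ∧
      (∀ a, ({v₁, v₂, v₃} : Set V) ⊆ (T a).verts) ∧
      (∀ a b, a ≠ b → (T a).verts ∩ (T b).verts = {v₁, v₂, v₃}) ∧
      (∀ a b, a ≠ b → Disjoint (T a).edgeSet (T b).edgeSet)) :
    ConnectsSet G ({v₁, v₂, v₃} : Set V) (m + 1) := by

  obtain ⟨n, rfl⟩ : ∃ n, m = n + 1 := ⟨m - 1, by omega⟩
  obtain ⟨T, hTA, hT, hTS, hTv, hTe⟩ := htrees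
  have hmatch : ∀ {v w w' : V}, G.Adj v w → G.Adj v w' → part w = part w' →
      part w ≠ part v → w = w' := by
    intro v w w' hw hw' hww' hwv
    obtain ⟨w₁, w₂, -, -, -, -, -, h, hall⟩ := hout v
    rcases hall w hw hwv with rfl | rfl <;> rcases hall w' hw' (hww' ▸ hwv) with rfl | rfl
    exacts [rfl, (h hww').elim, (h hww'.symm).elim, rfl]
  have hpart : ∀ j, (G.induce {v | part v = j}).Connected := fun j => by
    rw [← Set.sdiff_empty (s := {v | part v = j})]
    exact (hconn j).induce_diff_connected (Set.empty_subset _) (by simp)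
  have hpart' : ∀ j, ∀ v ∈ {v | part v = j}, (G.induce ({v | part v = j} \ {v})).Connected :=
    fun j v hv => (hconn j).induce_diff_connected (Set.singleton_subset_iff.2 hv)
      (by rw [Set.ncard_singleton]; omega)
  have hedge : ∀ j k, j ≠ k → ∀ v, ∃ u w, u ≠ v ∧ G.Adj u w ∧ part u = j ∧ part w = k := by
    intro j k hjk v
    have hlt := (hcross j k hjk).2
    obtain ⟨e, e', he, he', hne⟩ := (Set.one_lt_ncard_iff (Set.toFinite _)).1
      (show 1 < Set.ncard _ from lt_of_lt_of_le (by omega) hlt)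
    by_contra! h
    have h1 : e.1 = v := by
      by_contra h'
      exact h _ _ h' he.1 he.2.1 he.2.2
    have h2 : e'.1 = v := by
      by_contra h'
      exact h _ _ h' he'.1 he'.2.1 he'.2.2
    have h12 : e.1 = e'.1 := h1.trans h2.symm
    refine hne (Prod.ext h12 (hmatch he.1 (h12 ▸ he'.1) (he.2.2.trans he'.2.2.symm) ?_))
    rw [he.2.2, he.2.1]
    exact hjk.symm
  have hunion : ∀ P : Set (Fin p), P.Nonempty → (G.induce (part ⁻¹' P)).Connected :=
    fun P hP => SimpleGraph.connected_induce_preimage part hpart (fun j k hjk => by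
      obtain ⟨u, w, -, h⟩ := hedge j k hjk v₁
      exact ⟨u, w, h⟩) hP
  have hSA : ({v₁, v₂, v₃} : Set V) ⊆ {v | part v = i} := by
    rintro v (rfl | rfl | rfl) <;> assumption
  have hfinish : ∀ R₁ R₂ : Set V, (G.induce R₁).Connected → (G.induce R₂).Connected →
      (∀ v ∈ R₁, part v ≠ i) → (∀ v ∈ R₂, part v ≠ i) → Disjoint R₁ R₂ →
      (∀ v ∈ ({v₁, v₂, v₃} : Set V), ∃ w ∈ R₁, G.Adj v w) →
      (∀ v ∈ ({v₁, v₂, v₃} : Set V), ∃ w ∈ R₂, G.Adj v w) →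
      ConnectsSet G {v₁, v₂, v₃} (n + 2) := fun R₁ R₂ hR₁ hR₂ hi₁ hi₂ =>
    SimpleGraph.connectsSet_add_two T hTA hT hTS hTv hTe hSA hR₁ hR₂
      (Set.disjoint_right.2 hi₁) (Set.disjoint_right.2 hi₂)
  obtain ⟨a₁, b₁, -, ha₁, hb₁, hai₁, hbi₁, hab₁, -⟩ := hout v₁
  obtain ⟨a₂, b₂, -, ha₂, hb₂, hai₂, hbi₂, hab₂, -⟩ := hout v₂
  obtain ⟨a₃, b₃, -, ha₃, hb₃, hai₃, hbi₃, hab₃, -⟩ := hout v₃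
  rw [hv₁] at hai₁ hbi₁
  rw [hv₂] at hai₂ hbi₂
  rw [hv₃] at hai₃ hbi₃
  rcases exists_coloring_or_triangle hab₁ hab₂ hab₃ with
    ⟨c, hc₁, hc₂, hc₃⟩ | ⟨X, Y, Z, hXY, hYZ, hXZ, h₁, h₂, h₃⟩
  · have hsel : ∀ {v a b : V}, G.Adj v a → G.Adj v b → part a ≠ i → part b ≠ i →
        ¬ (c (part a) ↔ c (part b)) →
        (∃ w ∈ part ⁻¹' {j | j ≠ i ∧ c j}, G.Adj v w) ∧
        (∃ w ∈ part ⁻¹' {j | j ≠ i ∧ ¬ c j}, G.Adj v w) := by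
      intro v a b ha hb hai hbi hc
      by_cases hca : c (part a)
      · have hcb : ¬ c (part b) := by tauto
        exact ⟨⟨a, ⟨hai, hca⟩, ha⟩, ⟨b, ⟨hbi, hcb⟩, hb⟩⟩
      · have hcb : c (part b) := by tauto
        exact ⟨⟨b, ⟨hbi, hcb⟩, hb⟩, ⟨a, ⟨hai, hca⟩, ha⟩⟩
    have s₁ := hsel ha₁ hb₁ hai₁ hbi₁ hc₁
    have s₂ := hsel ha₂ hb₂ hai₂ hbi₂ hc₂
    have s₃ := hsel ha₃ hb₃ hai₃ hbi₃ hc₃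
    refine hfinish (part ⁻¹' {j | j ≠ i ∧ c j}) (part ⁻¹' {j | j ≠ i ∧ ¬ c j})
      (hunion _ ?_) (hunion _ ?_) (fun v hv => hv.1) (fun v hv => hv.1)
      (Set.disjoint_left.2 fun v hv hv' => hv'.2 hv.2) ?_ ?_
    · obtain ⟨w, hw, -⟩ := s₁.1
      exact ⟨_, hw⟩
    · obtain ⟨w, hw, -⟩ := s₁.2
      exact ⟨_, hw⟩
    · rintro v (rfl | rfl | rfl)
      exacts [s₁.1, s₂.1, s₃.1]
    · rintro v (rfl | rfl | rfl)
      exacts [s₁.2, s₂.2, s₃.2]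
  · have horient : ∀ {v a b : V} {J K : Fin p}, G.Adj v a → G.Adj v b → part a ≠ i → part b ≠ i →
        (part a = J ∧ part b = K ∨ part a = K ∧ part b = J) →
        J ≠ i ∧ K ≠ i ∧ ∃ x y, G.Adj v x ∧ G.Adj v y ∧ part x = J ∧ part y = K := by
      rintro v a b J K ha hb hai hbi (⟨rfl, rfl⟩ | ⟨rfl, rfl⟩)
      exacts [⟨hai, hbi, a, b, ha, hb, rfl, rfl⟩, ⟨hbi, hai, b, a, hb, ha, rfl, rfl⟩]
    obtain ⟨hXi, hYi, x₁, y₁, hx₁, hy₁, hx₁X, hy₁Y⟩ := horient ha₁ hb₁ hai₁ hbi₁ h₁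
    obtain ⟨-, hZi, y₂, z₂, hy₂, hz₂, hy₂Y, hz₂Z⟩ := horient ha₂ hb₂ hai₂ hbi₂ h₂
    obtain ⟨-, -, z₃, x₃, hz₃, hx₃, hz₃Z, hx₃X⟩ := horient ha₃ hb₃ hai₃ hbi₃ h₃
    have hzz : z₂ ≠ z₃ := by
      rintro rfl
      refine h23 (hmatch hz₂.symm hz₃.symm (hv₂.trans hv₃.symm) ?_)
      rw [hv₂, hz₂Z]
      exact hZi.symm
    have hfresh : ∀ s : Finset (Fin p), s.card ≤ 5 → ∃ j, j ∉ s := by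
      intro s hs
      by_contra! h
      have := Finset.card_fin p ▸ (Finset.eq_univ_iff_forall.2 h ▸ hs)
      omega
    obtain ⟨W, hW⟩ := hfresh {i, X, Y, Z} (Finset.card_le_four.trans (by norm_num))
    obtain ⟨U, hU⟩ := hfresh {i, X, Y, Z, W} Finset.card_le_five
    simp only [Finset.mem_insert, Finset.mem_singleton, not_or] at hW hU
    let E : Set V := {v | ∃ w, G.Adj v w ∧ (part w = W ∨ part w = U)}
    obtain ⟨e, w, hez, hew, heZ, hwW⟩ := hedge Z W (Ne.symm hW.2.2.2) z₃
    obtain ⟨C, hCZ, hzC, hzC', hC, hD, v, hvC, ⟨u, hvu, hu⟩, hvE⟩ :=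
      SimpleGraph.exists_connected_split (hpart' Z) (E := E) hz₂Z hz₃Z hzz heZ
        ⟨w, hew, .inl hwW⟩ hez
    have hregions : ∀ J K : Fin p, J ≠ K → J ≠ i → J ≠ X → J ≠ Y → J ≠ Z → K ≠ i → K ≠ X →
        K ≠ Y → K ≠ Z → part u = J → (∀ d f, G.Adj d f → part f = K → d ∈ E) →
        ConnectsSet G {v₁, v₂, v₃} (n + 2) := by
      intro J K hJK hJi hJX hJY hJZ hKi hKX hKY hKZ huJ hKE
      obtain ⟨d, f, hdv, hdf, hdZ, hfK⟩ := hedge Z K hKZ.symm v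
      have hdC : d ∉ C := fun h => hdv (hvE d h (hKE d f hdf hfK))
      refine hfinish (part ⁻¹' {X, J} ∪ C) (part ⁻¹' {Y, K} ∪ ({v | part v = Z} \ C))
        ((hunion _ ⟨X, .inl rfl⟩).induce_union_of_adj hC (.inr huJ) hvC hvu.symm)
        ((hunion _ ⟨Y, .inl rfl⟩).induce_union_of_adj hD (.inr hfK) ⟨hdZ, hdC⟩ hdf.symm)
        ?_ ?_ ?_ ?_ ?_
      · rintro t ((h | h) | h) hti
        exacts [hXi (h.symm.trans hti), hJi (h.symm.trans hti), hZi ((hCZ h).symm.trans hti)]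
      · rintro t ((h | h) | h) hti
        exacts [hYi (h.symm.trans hti), hKi (h.symm.trans hti), hZi (h.1.symm.trans hti)]
      · rw [Set.disjoint_left]
        rintro t ((h | h) | h) ((h' | h') | h')
        exacts [hXY (h.symm.trans h'), hKX (h'.symm.trans h), hXZ (h.symm.trans h'.1),
          hJY (h.symm.trans h'), hJK (h.symm.trans h'), hJZ (h.symm.trans h'.1),
          hYZ (h'.symm.trans (hCZ h)), hKZ (h'.symm.trans (hCZ h)), h'.2 h]
      · rintro t (rfl | rfl | rfl)
        exacts [⟨x₁, .inl (.inl hx₁X), hx₁⟩, ⟨z₂, .inr hzC, hz₂⟩, ⟨x₃, .inl (.inl hx₃X), hx₃⟩]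
      · rintro t (rfl | rfl | rfl)
        exacts [⟨y₁, .inl (.inl hy₁Y), hy₁⟩, ⟨y₂, .inl (.inl hy₂Y), hy₂⟩,
          ⟨z₃, .inr ⟨hz₃Z, hzC'⟩, hz₃⟩]
    obtain ⟨hWi, hWX, hWY, hWZ⟩ := hW
    obtain ⟨hUi, hUX, hUY, hUZ, hUW⟩ := hU
    rcases hu with hu | hu
    · exact hregions W U (Ne.symm hUW) hWi hWX hWY hWZ hUi hUX hUY hUZ hu
        fun d f hdf hf => ⟨f, hdf, .inr hf⟩
    · exact hregions U W hUW hUi hUX hUY hUZ hWi hWX hWY hWZ hu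
        fun d f hdf hf => ⟨f, hdf, .inl hf⟩
end

section
/- Let m ≥ 4 and p ≥ 7 be integers and let G be a finite simple graph that is (m+2)-regular and (m+2)-connected, whose vertex set is partitioned into p parts V_1, …, V_p, each of size q, such that: (i) each induced subgraph G[V_i] is m-regular and m-connected; (ii) every vertex of V_i has exactly two neighbours of G outside V_i ('outside neighbours'), and these two outside neighbours lie in two distinct parts other than V_i; (iii) for any two distinct parts V_i and V_j the number of edges of G between V_i and V_j equals 2q/(p−1), and 2q/(p−1) ≥ m + 2; (iv) any two vertices lying in different parts have at most one common outside neighbour. If for every part V_i and every 3-element set S ⊆ V_i there exist m − 1 internally disjoint trees connecting S in G[V_i], then κ₃(G) ≥ m + 1. -/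
/-- `κ_G(S)`: the maximum number of internally disjoint trees connecting `S` in `G`. -/
noncomputable def treeConn {V : Type*} (G : SimpleGraph V) (S : Set V) : ℕ :=
  sSup {r | ConnectsSet G S r}

/-- The generalized 3-connectivity `κ₃(G) = min {κ_G(S) : S ⊆ V(G), |S| = 3}`. -/
noncomputable def kappa3 {V : Type*} (G : SimpleGraph V) : ℕ :=
  sInf {k | ∃ S : Set V, S.ncard = 3 ∧ treeConn G S = k}

/-- The vertex set `Y` is nonempty and induces a connected subgraph of `G`. -/
def ConnOn {V : Type*} (G : SimpleGraph V) (Y : Set V) : Prop :=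
  Y.Nonempty ∧ ∀ Z ⊆ Y, Z.Nonempty → (∀ v ∈ Z, ∀ w ∈ Y, G.Adj v w → w ∈ Z) → Y ⊆ Z

/-- The vertex `x` has a neighbour in `Y`. -/
def Touches {V : Type*} (G : SimpleGraph V) (x : V) (Y : Set V) : Prop :=
  ∃ u ∈ Y, G.Adj x u

namespace ConnOn

variable {V : Type*} {G H : SimpleGraph V} {Y Y₁ Y₂ : Set V}

theorem mono (hGH : G ≤ H) (h : ConnOn G Y) : ConnOn H Y :=
  ⟨h.1, fun Z hZ hne hcl => h.2 Z hZ hne fun v hv w hw hvw => hcl v hv w hw (hGH hvw)⟩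

theorem singleton (G : SimpleGraph V) (x : V) : ConnOn G {x} := by
  refine ⟨Set.singleton_nonempty x, fun Z hZ hne _ => ?_⟩
  obtain ⟨z, hz⟩ := hne
  have : z = x := hZ hz
  subst this
  simpa using hz

theorem union (h₁ : ConnOn G Y₁) (h₂ : ConnOn G Y₂)
    (h : ∃ u ∈ Y₁, ∃ v ∈ Y₂, u = v ∨ G.Adj u v) : ConnOn G (Y₁ ∪ Y₂) := by
  refine ⟨h₁.1.mono Set.subset_union_left, fun Z hZ hne hcl => ?_⟩
  obtain ⟨u, hu, v, hv, huv⟩ := h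
  have k₁ : (Z ∩ Y₁).Nonempty → Y₁ ⊆ Z := fun hn =>
    (h₁.2 (Z ∩ Y₁) Set.inter_subset_right hn fun a ha b hb hab =>
      ⟨hcl a ha.1 b (Or.inl hb) hab, hb⟩).trans Set.inter_subset_left
  have k₂ : (Z ∩ Y₂).Nonempty → Y₂ ⊆ Z := fun hn =>
    (h₂.2 (Z ∩ Y₂) Set.inter_subset_right hn fun a ha b hb hab =>
      ⟨hcl a ha.1 b (Or.inr hb) hab, hb⟩).trans Set.inter_subset_left
  have e₁ : Y₁ ⊆ Z → Y₂ ⊆ Z := fun hs => k₂ ⟨v, by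
    rcases huv with rfl | huv
    · exact hs hu
    · exact hcl u (hs hu) v (Or.inr hv) huv, hv⟩
  have e₂ : Y₂ ⊆ Z → Y₁ ⊆ Z := fun hs => k₁ ⟨u, by
    rcases huv with rfl | huv
    · exact hs hv
    · exact hcl v (hs hv) u (Or.inl hu) huv.symm, hu⟩
  obtain ⟨z, hz⟩ := hne
  rcases hZ hz with hz' | hz'
  · have := k₁ ⟨z, hz, hz'⟩
    exact Set.union_subset this (e₁ this)
  · have := k₂ ⟨z, hz, hz'⟩
    exact Set.union_subset (e₂ this) this

theorem insert_of_touches {x : V} (h : ConnOn G Y) (hx : Touches G x Y) :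
    ConnOn G (insert x Y) := by
  rw [Set.insert_eq]
  obtain ⟨u, hu, hxu⟩ := hx
  exact (singleton G x).union h ⟨x, rfl, u, hu, Or.inr hxu⟩

theorem exists_adj_of_ssubset {Z : Set V} (h : ConnOn G Y) (hZ : Z ⊆ Y) (hne : Z.Nonempty)
    (hY : ¬ Y ⊆ Z) : ∃ v ∈ Z, ∃ w ∈ Y, w ∉ Z ∧ G.Adj v w := by
  by_contra hcon
  push Not at hcon
  refine hY (h.2 Z hZ hne fun v hv w hw hvw => ?_)
  by_contra hwZ
  exact hcon v hv w hw hwZ hvw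

theorem subset_of_closed {Z : Set V} (h : ConnOn G Y) (hne : (Y ∩ Z).Nonempty)
    (hcl : ∀ v ∈ Z, ∀ w ∈ Y, G.Adj v w → w ∈ Z) : Y ⊆ Z :=
  (h.2 (Y ∩ Z) Set.inter_subset_left hne fun v hv w hw hvw =>
    ⟨hw, hcl v hv.2 w hw hvw⟩).trans Set.inter_subset_right

end ConnOn

theorem connOn_iff_induce_connected {V : Type*} {G : SimpleGraph V} {Y : Set V} :
    ConnOn G Y ↔ (G.induce Y).Connected := by
  constructor
  · rintro ⟨⟨u, hu⟩, h⟩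
    rw [SimpleGraph.connected_iff]
    refine ⟨?_, ⟨⟨u, hu⟩⟩⟩
    intro a b
    have := h {v | ∃ hv : v ∈ Y, (G.induce Y).Reachable a ⟨v, hv⟩} (fun v hv => hv.1)
      ⟨a, a.2, SimpleGraph.Reachable.refl _⟩ (by
        rintro v ⟨hv, hr⟩ w hw hvw
        exact ⟨hw, hr.trans (SimpleGraph.Adj.reachable (by simpa using hvw))⟩) b.2
    exact this.2
  · intro h
    obtain ⟨⟨u, hu⟩⟩ := h.nonempty
    refine ⟨⟨u, hu⟩, fun Z hZ ⟨z, hz⟩ hcl w hw => ?_⟩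
    obtain ⟨p⟩ := h.preconnected ⟨z, hZ hz⟩ ⟨w, hw⟩
    have key : ∀ a b : Y, (G.induce Y).Walk a b → (a : V) ∈ Z → (b : V) ∈ Z := by
      intro a b p
      induction p with
      | nil => exact id
      | cons hadj _ ih => exact fun ha => ih (hcl _ ha _ (Subtype.coe_prop _) (by simpa using hadj))
    exact key _ _ p hz

/-- A disjoint family of connected sets inside a connected set can be enlarged to cover it. -/
theorem ConnOn.exists_cover {V ι : Type*} [Finite V] [Nonempty ι] {G : SimpleGraph V} {D : Set V}
    (hD : ConnOn G D) (Q : ι → Set V) (hQ : ∀ i, ConnOn G (Q i)) (hQD : ∀ i, Q i ⊆ D)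
    (hdisj : Pairwise fun i j => Disjoint (Q i) (Q j)) :
    ∃ Q' : ι → Set V, (∀ i, Q i ⊆ Q' i) ∧ (∀ i, ConnOn G (Q' i)) ∧ (∀ i, Q' i ⊆ D) ∧
      (Pairwise fun i j => Disjoint (Q' i) (Q' j)) ∧ ∀ v ∈ D, ∃ i, v ∈ Q' i := by
  classical
  induction hn : (D \ ⋃ i, Q i).ncard using Nat.strong_induction_on generalizing Q with
  | _ n ih =>
    by_cases hcov : D ⊆ ⋃ i, Q i
    · exact ⟨Q, fun _ => subset_rfl, hQ, hQD, hdisj, fun v hv => by simpa using hcov hv⟩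
    · obtain ⟨i₀⟩ := ‹Nonempty ι›
      obtain ⟨u, hu⟩ := (hQ i₀).1
      obtain ⟨v, hv, w, hw, hwn, hvw⟩ := hD.exists_adj_of_ssubset (Set.iUnion_subset hQD)
        ⟨u, Set.mem_iUnion.2 ⟨i₀, hu⟩⟩ hcov
      obtain ⟨i, hi⟩ := Set.mem_iUnion.1 hv
      have hwn' : ∀ j, w ∉ Q j := fun j hj => hwn (Set.mem_iUnion.2 ⟨j, hj⟩)
      have hle : ∀ j, Q j ⊆ Function.update Q i (insert w (Q i)) j := by
        intro j
        by_cases hj : j = i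
        · subst hj; simp
        · simp [hj]
      obtain ⟨Q', h1, h2⟩ := ih _ (by
        rw [← hn]
        refine Set.ncard_lt_ncard ⟨?_, fun hsub => ?_⟩ (Set.toFinite _)
        · exact Set.sdiff_subset_sdiff_right (Set.iUnion_mono hle)
        · exact (hsub ⟨hw, hwn⟩).2 (Set.mem_iUnion.2 ⟨i, by simp⟩))
        (Function.update Q i (insert w (Q i))) (by
          intro j
          by_cases hj : j = i
          · subst hj
            simpa using (hQ j).insert_of_touches ⟨v, hi, hvw.symm⟩
          · simpa [hj] using hQ j) (by
          intro j
          by_cases hj : j = i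
          · subst hj
            simpa using Set.insert_subset hw (hQD j)
          · simpa [hj] using hQD j) (by
          intro a b hab
          by_cases ha : a = i
          · subst ha
            have hb : b ≠ a := hab.symm
            simpa [hb] using ⟨hwn' b, hdisj hab⟩
          · by_cases hb : b = i
            · subst hb
              simpa [ha] using ⟨hwn' a, hdisj hab⟩
            · simpa [ha, hb] using hdisj hab) rfl
      exact ⟨Q', fun j => (hle j).trans (h1 j), h2⟩

/-- `Z` is a side of a separation of `A` from `B` with separator `X`: every vertex of `A` lies
in `Z ∪ X`, no vertex of `B` lies in `Z`, and `Z` has no neighbour outside `Z ∪ X`. -/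
structure IsSeparation {V : Type*} (G : SimpleGraph V) (A B Z X : Set V) : Prop where
  disj : Disjoint Z X
  left : A ⊆ Z ∪ X
  right : Disjoint Z B
  closed : ∀ v ∈ Z, ∀ w, G.Adj v w → w ∈ Z ∪ X

namespace IsSeparation

variable {V : Type*} {G G' : SimpleGraph V} {A B Z X S : Set V}

theorem flip (h : IsSeparation G A B Z X) : IsSeparation G B A (Z ∪ X)ᶜ X where
  disj := by
    rw [Set.disjoint_left]
    exact fun v hv hX => hv (Or.inr hX)
  left := fun v hv => by
    by_cases hX : v ∈ X
    · exact Or.inr hX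
    · refine Or.inl fun hZX => ?_
      rcases hZX with hZ | hX'
      · exact Set.disjoint_left.1 h.right hZ hv
      · exact hX hX'
  right := by
    rw [Set.disjoint_left]
    exact fun v hv hA => hv (h.left hA)
  closed := fun v hv w hvw => by
    by_cases hX : w ∈ X
    · exact Or.inr hX
    · refine Or.inl fun hw => ?_
      rcases hw with hw | hw
      · exact hv (h.closed w hw v hvw.symm)
      · exact hX hw

theorem exists_side_family [Finite V] {x y : V} {k : ℕ} (hsep : IsSeparation G' A B Z S)
    (hx : x ∈ Z) (hy : y ∉ Z ∪ S)
    (hG : ∀ a b, G.Adj a b → ¬ G'.Adj a b → (a = x ∧ b = y) ∨ (a = y ∧ b = x))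
    (hk : ∀ Z X, IsSeparation G A B Z X → k ≤ X.ncard) (hS : S.ncard + 1 = k)
    (ih : ∀ P : Set V, (∀ Z X, IsSeparation G' A P Z X → k ≤ X.ncard) →
      ∃ C : Fin k → Set V, (Pairwise fun i j => Disjoint (C i) (C j)) ∧
        ∀ i, ConnOn G' (C i) ∧ (C i ∩ A).Nonempty ∧ (C i ∩ P).Nonempty) :
    ∃ C : V → Set V, (∀ s ∈ insert x S, ∀ t ∈ insert x S, s ≠ t → Disjoint (C s) (C t)) ∧
      ∀ s ∈ insert x S, ConnOn G' (C s) ∧ (C s ∩ A).Nonempty ∧ s ∈ C s ∧ C s ⊆ Z ∪ S := by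
  classical
  have hxS : x ∉ S := Set.disjoint_left.1 hsep.disj hx
  have hPk : (insert x S).ncard = k := by rw [Set.ncard_insert_of_notMem hxS, hS]
  obtain ⟨C, hdisj, hC⟩ := ih (insert x S) (by
    intro Z' X h'
    refine hk (Z' ∩ Z) X ⟨h'.disj.mono_left Set.inter_subset_left, ?_,
      hsep.right.mono_left Set.inter_subset_right, ?_⟩
    · intro a ha
      rcases h'.left ha with h1 | h1
      · rcases hsep.left ha with h2 | h2
        · exact Or.inl ⟨h1, h2⟩
        · exact absurd (Or.inr h2) (Set.disjoint_left.1 h'.right h1)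
      · exact Or.inr h1
    · rintro v ⟨hv', hv⟩ w hvw
      have hvP := Set.disjoint_left.1 h'.right hv'
      have hvw' : G'.Adj v w := by
        by_contra hcon
        rcases hG v w hvw hcon with ⟨rfl, -⟩ | ⟨rfl, -⟩
        · exact hvP (Or.inl rfl)
        · exact hy (Or.inl hv)
      rcases h'.closed v hv' w hvw' with h1 | h1
      · rcases hsep.closed v hv w hvw' with h2 | h2
        · exact Or.inl ⟨h1, h2⟩
        · exact absurd (Or.inr h2) (Set.disjoint_left.1 h'.right h1)
      · exact Or.inr h1)
  choose hconn hA hP using hC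
  choose p hp using hP
  have hinj : Function.Injective fun i => (⟨p i, (hp i).2⟩ : ↥(insert x S)) := by
    intro i j hij
    by_contra hne
    have : p i = p j := congrArg Subtype.val hij
    exact Set.disjoint_left.1 (hdisj hne) (hp i).1 (this ▸ (hp j).1)
  have hsurj : Function.Surjective fun i => (⟨p i, (hp i).2⟩ : ↥(insert x S)) := by
    refine (Function.Injective.bijective_of_nat_card_le hinj ?_).2
    rw [Nat.card_coe_set_eq, hPk, Nat.card_fin]
  have huniq : ∀ i, ∀ s ∈ insert x S, s ∈ C i → s = p i := by
    intro i s hs hsC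
    obtain ⟨j, hj⟩ := hsurj ⟨s, hs⟩
    have hj' : p j = s := congrArg Subtype.val hj
    by_contra hne
    have hij : i ≠ j := fun h => hne (by rw [h, hj'])
    exact Set.disjoint_left.1 (hdisj hij) hsC (hj' ▸ (hp j).1)
  have hinv : ∀ s : V, ∃ i, s ∈ insert x S → p i = s := by
    intro s
    by_cases hs : s ∈ insert x S
    · obtain ⟨i, hi⟩ := hsurj ⟨s, hs⟩
      exact ⟨i, fun _ => congrArg Subtype.val hi⟩
    · obtain ⟨i, -⟩ := hsurj ⟨x, Or.inl rfl⟩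
      exact ⟨i, fun h => absurd h hs⟩
  choose idx hidx using hinv
  refine ⟨fun s => C (idx s) ∩ (Z ∪ S), ?_, ?_⟩
  · intro s hs t ht hst
    refine (hdisj fun h => hst ?_).mono Set.inter_subset_left Set.inter_subset_left
    rw [← hidx s hs, ← hidx t ht, h]
  · intro s hs
    have hps := hidx s hs
    have hsub : insert x S ⊆ Z ∪ S := Set.insert_subset (Or.inl hx) Set.subset_union_right
    have hsC : s ∈ C (idx s) := by
      have := (hp (idx s)).1
      rwa [hps] at this
    have key : ∀ W ⊆ C (idx s) ∩ (Z ∪ S), W.Nonempty →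
        (∀ v ∈ W, ∀ w ∈ C (idx s) ∩ (Z ∪ S), G'.Adj v w → w ∈ W) → s ∈ W := by
      intro W hW hne hcl
      by_contra hsW
      have hWZ : W ⊆ Z := fun v hv => by
        rcases (hW hv).2 with h | h
        · exact h
        · have := huniq (idx s) v (Or.inr h) (hW hv).1
          exact absurd hv (by rw [this, hps]; exact hsW)
      exact hsW ((hconn (idx s)).2 W (fun v hv => (hW hv).1) hne (fun v hv w hw hvw =>
        hcl v hv w ⟨hw, hsep.closed v (hWZ hv) w hvw⟩ hvw) hsC)
    refine ⟨⟨⟨s, hsC, hsub hs⟩, fun W hW hne hcl v hv => ?_⟩, ?_, ⟨hsC, hsub hs⟩,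
      Set.inter_subset_right⟩
    · by_contra hvW
      refine (key _ Set.sdiff_subset ⟨v, hv, hvW⟩ fun a ha b hb hab => ⟨hb, fun hbW =>
        ha.2 (hcl b hbW a ha.1 hab.symm)⟩ : s ∈ (C (idx s) ∩ (Z ∪ S)) \ W).2 (key W hW hne hcl)
    · obtain ⟨a, haC, haA⟩ := hA (idx s)
      exact ⟨a, ⟨haC, hsep.left haA⟩, haA⟩

end IsSeparation

/-- Menger's theorem: if every separation of `A` from `B` has order at least `k`, then there
are `k` disjoint connected sets meeting both `A` and `B`. -/
theorem exists_disjoint_connOn_of_separations {V : Type*} [Finite V] (G : SimpleGraph V)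
    (A B : Set V) (k : ℕ) (hk : ∀ Z X, IsSeparation G A B Z X → k ≤ X.ncard) :
    ∃ C : Fin k → Set V, (Pairwise fun i j => Disjoint (C i) (C j)) ∧
      ∀ i, ConnOn G (C i) ∧ (C i ∩ A).Nonempty ∧ (C i ∩ B).Nonempty := by
  classical
  induction G using WellFoundedLT.induction generalizing A B with
  | _ G ih =>
    by_cases hbot : G = ⊥
    · subst hbot
      have h := hk (A \ B) (A ∩ B) ⟨by
        rw [Set.disjoint_left]; exact fun v hv hv' => hv.2 hv'.2, by simp,
        Set.disjoint_sdiff_left, by simp⟩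
      obtain ⟨t, ht, htc⟩ := Set.exists_subset_card_eq h
      have hcard : Nat.card (Fin k) = Nat.card t := by
        rw [Nat.card_fin, Nat.card_coe_set_eq, htc]
      obtain ⟨e⟩ := (Finite.card_eq (α := Fin k) (β := t)).1 hcard
      refine ⟨fun i => {(e i : V)}, fun i j hij => ?_, fun i => ⟨ConnOn.singleton _ _, ?_, ?_⟩⟩
      · simpa using fun h : (e i : V) = e j => hij (e.injective (Subtype.ext h))
      · exact ⟨e i, rfl, (ht (e i).2).1⟩
      · exact ⟨e i, rfl, (ht (e i).2).2⟩
    · obtain ⟨x₀, y₀, hxy₀⟩ := SimpleGraph.ne_bot_iff_exists_adj.1 hbot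
      set G' := G.deleteEdges {s(x₀, y₀)} with hG'
      have hle : G' ≤ G := SimpleGraph.deleteEdges_le _
      have hlt : G' < G := by
        refine lt_of_le_of_ne hle fun h => ?_
        rw [← h, hG'] at hxy₀
        simp at hxy₀
      have hadj : ∀ a b, G.Adj a b → ¬ G'.Adj a b → s(a, b) = s(x₀, y₀) := by
        intro a b h1 h2
        by_contra h3
        exact h2 (by rw [hG', SimpleGraph.deleteEdges_adj]; exact ⟨h1, by simpa using h3⟩)
      by_cases hall : ∀ Z X, IsSeparation G' A B Z X → k ≤ X.ncard
      · obtain ⟨C, h1, h2⟩ := ih G' hlt A B hall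
        exact ⟨C, h1, fun i => ⟨(h2 i).1.mono hle, (h2 i).2⟩⟩
      · push Not at hall
        obtain ⟨Z, S, hsep, hSk⟩ := hall
        have hncl : ∃ x ∈ Z, ∃ y, G.Adj x y ∧ y ∉ Z ∪ S := by
          by_contra hcon
          push Not at hcon
          exact absurd (hk Z S ⟨hsep.disj, hsep.left, hsep.right, hcon⟩) (by omega)
        obtain ⟨x, hx, y, hxy, hy⟩ := hncl
        have hxS : x ∉ S := Set.disjoint_left.1 hsep.disj hx
        have hxy' : s(x, y) = s(x₀, y₀) :=
          hadj x y hxy fun h => hy (hsep.closed x hx y h)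
        have hG : ∀ a b, G.Adj a b → ¬ G'.Adj a b → (a = x ∧ b = y) ∨ (a = y ∧ b = x) := by
          intro a b h1 h2
          have := hadj a b h1 h2
          rw [← hxy'] at this
          simpa using this
        have hS1 : S.ncard + 1 = k := by
          have := hk (Z \ {x}) (insert x S) ⟨by
            rw [Set.disjoint_left]
            rintro v ⟨hv, hvx⟩ (h | h)
            · exact hvx h
            · exact Set.disjoint_left.1 hsep.disj hv h, by
            intro a ha
            by_cases hax : a = x
            · exact Or.inr (Or.inl hax)
            · rcases hsep.left ha with h | h
              · exact Or.inl ⟨h, hax⟩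
              · exact Or.inr (Or.inr h), hsep.right.mono_left Set.sdiff_subset, by
            rintro v ⟨hv, hvx⟩ w hvw
            have hvw' : G'.Adj v w := by
              by_contra hcon
              rcases hG v w hvw hcon with ⟨rfl, -⟩ | ⟨rfl, -⟩
              · exact hvx rfl
              · exact hy (Or.inl hv)
            by_cases hwx : w = x
            · exact Or.inr (Or.inl hwx)
            · rcases hsep.closed v hv w hvw' with h | h
              · exact Or.inl ⟨h, hwx⟩
              · exact Or.inr (Or.inr h)⟩
          rw [Set.ncard_insert_of_notMem hxS] at this
          omega
        obtain ⟨C, hCd, hC⟩ := hsep.exists_side_family hx hy hG hk hS1 (ih G' hlt A)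
        obtain ⟨D, hDd, hD⟩ := hsep.flip.exists_side_family (x := y) (y := x) (G := G) hy
          (by rintro (h | h)
              · exact h (Or.inl hx)
              · exact hxS h)
          (fun a b h1 h2 => (hG a b h1 h2).symm) (fun Z X h => hk _ X h.flip) hS1 (ih G' hlt B)
        have hyS : y ∉ S := fun h => hy (Or.inr h)
        have hxy_ne : x ≠ y := hxy.ne
        let τ : V → V := fun s => if s = x then y else s
        have hτ : ∀ s ∈ insert x S, τ s ∈ insert y S := by
          rintro s (rfl | hs)
          · simp [τ]
          · have : s ≠ x := fun h => hxS (h ▸ hs)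
            simp [τ, this, hs]
        have hCD : ∀ s ∈ insert x S, ∀ t ∈ insert y S, ∀ u ∈ C s, u ∈ D t → s ∈ S ∧ s = t := by
          intro s hs t ht u hu hu'
          have huS : u ∈ S := by
            rcases (hC s hs).2.2.2 hu with h | h
            · rcases (hD t ht).2.2.2 hu' with h' | h'
              · exact absurd (Or.inl h) h'
              · exact h'
            · exact h
          have h1 : s = u := by
            by_contra hne
            exact Set.disjoint_left.1 (hCd s hs u (Or.inr huS) hne) hu (hC u (Or.inr huS)).2.2.1
          have h2 : t = u := by
            by_contra hne
            exact Set.disjoint_left.1 (hDd t ht u (Or.inr huS) hne) hu' (hD u (Or.inr huS)).2.2.1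
          exact ⟨h1 ▸ huS, h1.trans h2.symm⟩
        have hmix : ∀ s ∈ insert x S, ∀ t ∈ insert x S, s ≠ t → Disjoint (C s) (D (τ t)) := by
          intro s hs t ht hst
          rw [Set.disjoint_left]
          intro u hu hu'
          obtain ⟨h1, h2⟩ := hCD s hs (τ t) (hτ t ht) u hu hu'
          by_cases htx : t = x
          · simp only [τ, htx, if_true] at h2
            exact hyS (h2 ▸ h1)
          · simp only [τ, htx, if_false] at h2
            exact hst h2
        have hcard : Nat.card (Fin k) = Nat.card ↥(insert x S) := by
          rw [Nat.card_fin, Nat.card_coe_set_eq, Set.ncard_insert_of_notMem hxS, hS1]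
        obtain ⟨e⟩ := (Finite.card_eq (α := Fin k) (β := ↥(insert x S))).1 hcard
        refine ⟨fun i => C (e i) ∪ D (τ (e i)), fun i j hij => ?_, fun i => ⟨?_, ?_, ?_⟩⟩
        · have hne : (e i : V) ≠ e j := fun h => hij (e.injective (Subtype.ext h))
          have hτne : τ (e i) ≠ τ (e j) := by
            have h1 := (e i).2
            have h2 := (e j).2
            simp only [τ]
            split_ifs with h3 h4 h4
            · exact fun _ => hne (h3.trans h4.symm)
            · rintro rfl
              rcases h2 with h2 | h2
              · exact h4 h2
              · exact hyS h2
            · intro h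
              rcases h1 with h1 | h1
              · exact h3 h1
              · exact hyS (h ▸ h1)
            · exact hne
          refine Set.disjoint_union_left.2 ⟨Set.disjoint_union_right.2 ⟨?_, ?_⟩,
            Set.disjoint_union_right.2 ⟨?_, ?_⟩⟩
          · exact hCd _ (e i).2 _ (e j).2 hne
          · exact hmix _ (e i).2 _ (e j).2 hne
          · exact (hmix _ (e j).2 _ (e i).2 hne.symm).symm
          · exact hDd _ (hτ _ (e i).2) _ (hτ _ (e j).2) hτne
        · refine ((hC _ (e i).2).1.mono hle).union ((hD _ (hτ _ (e i).2)).1.mono hle)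
            ⟨e i, (hC _ (e i).2).2.2.1, τ (e i), (hD _ (hτ _ (e i).2)).2.2.1, ?_⟩
          by_cases h : (e i : V) = x
          · right
            simp only [τ, h, if_true]
            exact hxy
          · left
            simp [τ, h]
        · exact (hC _ (e i).2).2.1.mono (Set.inter_subset_inter_left _ Set.subset_union_left)
        · exact (hD _ (hτ _ (e i).2)).2.1.mono
            (Set.inter_subset_inter_left _ Set.subset_union_right)

/-- Menger's theorem inside a vertex set `D`. -/
theorem exists_disjoint_connOn_within {V : Type*} [Finite V] (G : SimpleGraph V)
    (D A B : Set V) (k : ℕ) (hA : A ⊆ D)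
    (hk : ∀ Z ⊆ D, ∀ X ⊆ D, X.ncard < k → Disjoint Z X → A ⊆ Z ∪ X →
      (∀ v ∈ Z, ∀ w ∈ D, G.Adj v w → w ∈ Z ∪ X) → (Z ∩ B).Nonempty) :
    ∃ C : Fin k → Set V, (Pairwise fun i j => Disjoint (C i) (C j)) ∧
      ∀ i, ConnOn G (C i) ∧ C i ⊆ D ∧ (C i ∩ A).Nonempty ∧ (C i ∩ B).Nonempty := by
  let G' : SimpleGraph V :=
    { Adj := fun a b => G.Adj a b ∧ a ∈ D ∧ b ∈ D
      symm := ⟨fun a b h => ⟨h.1.symm, h.2.2, h.2.1⟩⟩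
      loopless := ⟨fun a h => G.loopless.irrefl a h.1⟩ }
  obtain ⟨C, h1, h2⟩ := exists_disjoint_connOn_of_separations G' A B k (by
    intro Z X h
    by_contra hlt
    push Not at hlt
    obtain ⟨v, hv, hvB⟩ := hk (Z ∩ D) Set.inter_subset_right (X ∩ D) Set.inter_subset_right
      (lt_of_le_of_lt (Set.ncard_le_ncard Set.inter_subset_left (Set.toFinite _)) hlt)
      (h.disj.mono Set.inter_subset_left Set.inter_subset_left)
      (fun a ha => (h.left ha).imp (fun h => ⟨h, hA ha⟩) fun h => ⟨h, hA ha⟩)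
      (fun v hv w hw hvw => (h.closed v hv.1 w ⟨hvw, hv.2, hw⟩).imp (fun h => ⟨h, hw⟩)
        fun h => ⟨h, hw⟩)
    exact Set.disjoint_left.1 h.right hv.1 hvB)
  refine ⟨C, h1, fun i => ⟨(h2 i).1.mono (show G' ≤ G from fun a b h => h.1), ?_, (h2 i).2⟩⟩
  obtain ⟨a, ha, haA⟩ := (h2 i).2.1
  exact (h2 i).1.subset_of_closed ⟨a, ha, hA haA⟩ fun v _ w _ h => h.2.2

/-- The fan lemma inside a vertex set `D`: disjoint connected sets joining the neighbourhood of
`z` to prescribed distinct targets. -/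
theorem exists_fan_within {V ι : Type*} [Finite V] [Fintype ι] (G : SimpleGraph V) (D : Set V)
    (z : V) (T : ι → V)
    (hk : ∀ Z ⊆ D, ∀ X ⊆ D, X.ncard < Fintype.card ι → Disjoint Z X →
      (∀ v ∈ D, G.Adj z v → v ∈ Z ∪ X) →
      (∀ v ∈ Z, ∀ w ∈ D, G.Adj v w → w ∈ Z ∪ X) → ∃ i, T i ∈ Z) :
    ∃ C : ι → Set V, (Pairwise fun i j => Disjoint (C i) (C j)) ∧
      ∀ i, ConnOn G (C i) ∧ C i ⊆ D ∧ T i ∈ C i ∧ Touches G z (C i) := by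
  obtain ⟨C, hdisj, hC⟩ := exists_disjoint_connOn_within G D {v ∈ D | G.Adj z v} (Set.range T)
    (Fintype.card ι) (fun v hv => hv.1) (by
      intro Z hZ X hX hlt hd hA hcl
      obtain ⟨i, hi⟩ := hk Z hZ X hX hlt hd (fun v hv hzv => hA ⟨hv, hzv⟩) hcl
      exact ⟨T i, hi, i, rfl⟩)
  choose hconn hD hA hB using hC
  choose p hp hp' using hB
  choose f hf using hp'
  have hinj : Function.Injective f := by
    intro i j hij
    by_contra hne
    refine Set.disjoint_left.1 (hdisj hne) (hp i) ?_
    rw [← hf i, hij, hf j]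
    exact hp j
  have hbij : Function.Bijective f :=
    Function.Injective.bijective_of_nat_card_le hinj (by simp)
  let e := Equiv.ofBijective f hbij
  have he : ∀ i, f (e.symm i) = i := fun i => e.apply_symm_apply i
  refine ⟨fun i => C (e.symm i), fun i j hij => hdisj fun h => hij (e.symm.injective h),
    fun i => ⟨hconn _, hD _, ?_, ?_⟩⟩
  · have := hp (e.symm i)
    rwa [← hf, he] at this
  · obtain ⟨a, ha, haA⟩ := hA (e.symm i)
    exact ⟨a, ha, haA.2⟩

/-- Connected sets `U a ∪ S`, with the `U a` disjoint and no edge inside `S` used twice, give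
internally disjoint trees connecting `S`. -/
theorem connectsSet_of_connOn {V : Type*} [Finite V] {G : SimpleGraph V} {S : Set V} {r : ℕ}
    (K : Fin r → SimpleGraph V) (U : Fin r → Set V) (hK : ∀ a, K a ≤ G)
    (hconn : ∀ a, ConnOn (K a) (U a ∪ S))
    (hU : Pairwise fun a b => Disjoint (U a) (U b))
    (hS : ∀ a b, a ≠ b → ∀ u ∈ S, ∀ v ∈ S, (K a).Adj u v → ¬ (K b).Adj u v) :
    ConnectsSet G S r := by
  have hT : ∀ a, ∃ T ≤ (K a).induce (U a ∪ S), T.IsTree := fun a =>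
    (connOn_iff_induce_connected.1 (hconn a)).exists_isTree_le
  choose T hTle hT using hT
  let R : Fin r → G.Subgraph := fun a =>
    { verts := U a ∪ S
      Adj := fun u v => ∃ (hu : u ∈ U a ∪ S) (hv : v ∈ U a ∪ S), (T a).Adj ⟨u, hu⟩ ⟨v, hv⟩
      adj_sub := by
        rintro u v ⟨hu, hv, h⟩
        exact hK a (by simpa using hTle a h)
      edge_vert := by
        rintro u v ⟨hu, hv, h⟩
        exact hu
      symm := ⟨by
        rintro u v ⟨hu, hv, h⟩
        exact ⟨hv, hu, h.symm⟩⟩ }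
  have hinter : ∀ a b, a ≠ b → (U a ∪ S) ∩ (U b ∪ S) = S := by
    intro a b hab
    rw [← Set.inter_union_distrib_right, Set.disjoint_iff_inter_eq_empty.1 (hU hab),
      Set.empty_union]
  refine ⟨R, fun a => ?_, fun a => Set.subset_union_right, hinter, fun a b hab => ?_⟩
  · have : (R a).coe = T a := by
      ext u v
      simp [R]
    rw [this]
    exact hT a
  · rw [Set.disjoint_left]
    intro e
    induction e using Sym2.ind with
    | _ u v =>
      rintro ⟨hu, hv, h⟩ ⟨hu', hv', h'⟩
      have hu : u ∈ S := hinter a b hab ▸ ⟨hu, hu'⟩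
      have hv : v ∈ S := hinter a b hab ▸ ⟨hv, hv'⟩
      exact hS a b hab u hu v hv (by simpa using hTle a h) (by simpa using hTle b h')

/-- The graph `G` without its edges inside `S`. -/
def edgesOff {V : Type*} (G : SimpleGraph V) (S : Set V) : SimpleGraph V where
  Adj u v := G.Adj u v ∧ ¬ (u ∈ S ∧ v ∈ S)
  symm := ⟨fun _ _ h => ⟨h.1.symm, fun h' => h.2 h'.symm⟩⟩
  loopless := ⟨fun _ h => G.loopless.irrefl _ h.1⟩

theorem edgesOff_le {V : Type*} (G : SimpleGraph V) (S : Set V) : edgesOff G S ≤ G :=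
  fun _ _ h => h.1

theorem ConnOn.edgesOff {V : Type*} {G : SimpleGraph V} {S U : Set V} (h : ConnOn G U)
    (hU : Disjoint U S) : ConnOn (edgesOff G S) U :=
  ⟨h.1, fun Z hZ hne hcl => h.2 Z hZ hne fun v hv w hw hvw =>
    hcl v hv w hw ⟨hvw, fun h' => Set.disjoint_left.1 hU hw h'.2⟩⟩

theorem Touches.edgesOff {V : Type*} {G : SimpleGraph V} {S U : Set V} {x : V}
    (h : Touches G x U) (hU : Disjoint U S) : Touches (edgesOff G S) x U := by
  obtain ⟨u, hu, hxu⟩ := h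
  exact ⟨u, hu, hxu, fun h' => Set.disjoint_left.1 hU hu h'.2⟩

theorem Touches.mono {V : Type*} {G : SimpleGraph V} {U W : Set V} {x : V}
    (h : Touches G x U) (hUW : U ⊆ W) : Touches G x W := by
  obtain ⟨u, hu, hxu⟩ := h
  exact ⟨u, hUW hu, hxu⟩

theorem ConnOn.union_triple {V : Type*} {G : SimpleGraph V} {U : Set V} {x y z : V}
    (h : ConnOn G U) (hx : Touches G x U) (hy : Touches G y U) (hz : Touches G z U) :
    ConnOn G (U ∪ {x, y, z}) := by
  have h1 := ((h.insert_of_touches hz).insert_of_touches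
    (hy.mono (Set.subset_insert _ _))).insert_of_touches
    (hx.mono ((Set.subset_insert _ _).trans (Set.subset_insert _ _)))
  convert h1 using 1
  ext v
  simp only [Set.mem_union, Set.mem_insert_iff, Set.mem_singleton_iff]
  tauto

theorem ConnOn.union_two_triple {V : Type*} {G : SimpleGraph V} {U W : Set V} {x y z : V}
    (hU : ConnOn G U) (hx : Touches G x U) (hzU : Touches G z U)
    (hW : ConnOn G W) (hy : Touches G y W) (hzW : Touches G z W) :
    ConnOn G (U ∪ W ∪ {x, y, z}) := by
  obtain ⟨w, hw, hzw⟩ := hzW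
  have h1 := (hU.insert_of_touches hzU).insert_of_touches (hx.mono (Set.subset_insert _ _))
  have h2 := h1.union (hW.insert_of_touches hy)
    ⟨z, Or.inr (Or.inl rfl), w, Or.inr hw, Or.inr hzw⟩
  convert h2 using 1
  ext v
  simp only [Set.mem_union, Set.mem_insert_iff, Set.mem_singleton_iff]
  tauto

/-- A family of disjoint connected sets off `{x, y, z}`, each touching `x`, `y` and `z`. -/
structure IsUnitFamily {V κ : Type*} (G : SimpleGraph V) (x y z : V) (U : κ → Set V) : Prop where
  conn : ∀ k, ConnOn G (U k)
  off : ∀ k, Disjoint (U k) {x, y, z}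
  disj : Pairwise fun k l => Disjoint (U k) (U l)
  left : ∀ k, Touches G x (U k)
  mid : ∀ k, Touches G y (U k)
  right : ∀ k, Touches G z (U k)

theorem IsUnitFamily.connectsSet {V κ : Type*} [Finite V] [Fintype κ] {G : SimpleGraph V}
    {x y z : V} {U : κ → Set V} (hU : IsUnitFamily G x y z U) (E : Set V)
    (hE : ConnOn G (E ∪ {x, y, z}))
    (hEU : ∀ k, Disjoint E (U k)) :
    ConnectsSet G {x, y, z} (Fintype.card κ + 1) := by
  have e : Fin (Fintype.card κ + 1) ≃ Option κ :=
    (Fintype.equivFinOfCardEq (by simp)).symm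
  let K' : Option κ → SimpleGraph V := fun o => o.elim G fun _ => edgesOff G {x, y, z}
  let U' : Option κ → Set V := fun o => o.elim E U
  have hdisj : ∀ a b : Option κ, a ≠ b → Disjoint (U' a) (U' b) := by
    rintro (_ | a) (_ | b) hab
    · exact absurd rfl hab
    · exact hEU b
    · exact (hEU a).symm
    · exact hU.disj fun h => hab (by rw [h])
  refine connectsSet_of_connOn (fun a => K' (e a)) (fun a => U' (e a)) ?_ ?_ ?_ ?_
  · intro a
    rcases e a with _ | k
    · exact le_rfl
    · exact edgesOff_le _ _
  · intro a
    rcases e a with _ | k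
    · exact hE
    · exact ((hU.conn k).edgesOff (hU.off k)).union_triple ((hU.left k).edgesOff (hU.off k))
        ((hU.mid k).edgesOff (hU.off k)) ((hU.right k).edgesOff (hU.off k))
  · exact fun a b hab => hdisj _ _ fun h => hab (e.injective h)
  · intro a b hab u hu v hv h1 h2
    have hne : e a ≠ e b := fun h => hab (e.injective h)
    rcases ha : e a with _ | k
    · rcases hb : e b with _ | l
      · exact hne (ha.trans hb.symm)
      · simp only [hb] at h2
        exact h2.2 ⟨hu, hv⟩
    · simp only [ha] at h1
      exact h1.2 ⟨hu, hv⟩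

theorem IsUnitFamily.connectsSet_of_two {V κ : Type*} [Finite V] [Fintype κ] {G : SimpleGraph V}
    {x y z : V} {U : κ → Set V} (hU : IsUnitFamily G x y z U) (E F F' : Set V)
    (hE : ConnOn G (E ∪ {x, y, z}))
    (hF : ConnOn G F) (hF' : ConnOn G F') (hFoff : Disjoint F {x, y, z})
    (hFoff' : Disjoint F' {x, y, z})
    (hxF : Touches G x F) (hzF : Touches G z F) (hyF : Touches G y F') (hzF' : Touches G z F')
    (hEF : Disjoint E (F ∪ F'))
    (hEU : ∀ k, Disjoint E (U k)) (hFU : ∀ k, Disjoint (F ∪ F') (U k)) :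
    ConnectsSet G {x, y, z} (Fintype.card κ + 2) := by
  have e : Fin (Fintype.card κ + 2) ≃ Option (Option κ) :=
    (Fintype.equivFinOfCardEq (by simp)).symm
  let K' : Option (Option κ) → SimpleGraph V := fun o => o.elim G fun _ => edgesOff G {x, y, z}
  let U' : Option (Option κ) → Set V := fun o => o.elim E fun o => o.elim (F ∪ F') U
  have hdisj : ∀ a b : Option (Option κ), a ≠ b → Disjoint (U' a) (U' b) := by
    rintro (_ | _ | a) (_ | _ | b) hab
    · exact absurd rfl hab
    · exact hEF
    · exact hEU b
    · exact hEF.symm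
    · exact absurd rfl hab
    · exact hFU b
    · exact (hEU a).symm
    · exact (hFU a).symm
    · exact hU.disj fun h => hab (by rw [h])
  refine connectsSet_of_connOn (fun a => K' (e a)) (fun a => U' (e a)) ?_ ?_ ?_ ?_
  · intro a
    rcases e a with _ | k
    · exact le_rfl
    · exact edgesOff_le _ _
  · intro a
    rcases e a with _ | _ | k
    · exact hE
    · exact (hF.edgesOff hFoff).union_two_triple (hxF.edgesOff hFoff) (hzF.edgesOff hFoff)
        (hF'.edgesOff hFoff') (hyF.edgesOff hFoff') (hzF'.edgesOff hFoff')
    · exact ((hU.conn k).edgesOff (hU.off k)).union_triple ((hU.left k).edgesOff (hU.off k))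
        ((hU.mid k).edgesOff (hU.off k)) ((hU.right k).edgesOff (hU.off k))
  · exact fun a b hab => hdisj _ _ fun h => hab (e.injective h)
  · intro a b hab u hu v hv h1 h2
    have hne : e a ≠ e b := fun h => hab (e.injective h)
    rcases ha : e a with _ | k
    · rcases hb : e b with _ | l
      · exact hne (ha.trans hb.symm)
      · simp only [hb] at h2
        exact h2.2 ⟨hu, hv⟩
    · simp only [ha] at h1
      exact h1.2 ⟨hu, hv⟩

/-- Trees connecting `S` inside `D` together with two hubs outside `D`. -/
theorem connectsSet_of_trees_of_hubs {V : Type*} [Finite V] {G : SimpleGraph V} {S D : Set V}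
    {n : ℕ} (T : Fin n → G.Subgraph) (hTD : ∀ a, (T a).verts ⊆ D)
    (hT : ∀ a, (T a).coe.IsTree) (hTS : ∀ a, S ⊆ (T a).verts)
    (hTi : ∀ a b, a ≠ b → (T a).verts ∩ (T b).verts = S)
    (hTe : ∀ a b, a ≠ b → Disjoint (T a).edgeSet (T b).edgeSet)
    (F : Bool → Set V) (hF : ∀ b, ConnOn (edgesOff G S) (F b ∪ S))
    (hFD : ∀ b, Disjoint (F b) D) (hFF : Disjoint (F true) (F false)) :
    ConnectsSet G S (n + 2) := by
  have e : Fin (n + 2) ≃ Bool ⊕ Fin n := (Fintype.equivFinOfCardEq (by simp; omega)).symm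
  let K' : Bool ⊕ Fin n → SimpleGraph V :=
    Sum.elim (fun _ => edgesOff G S) fun a => (T a).spanningCoe
  let U' : Bool ⊕ Fin n → Set V := Sum.elim F fun a => (T a).verts \ S
  have hFT : ∀ b a, Disjoint (F b) ((T a).verts \ S) := fun b a =>
    (hFD b).mono_right (Set.sdiff_subset.trans (hTD a))
  have hdisj : ∀ a b, a ≠ b → Disjoint (U' a) (U' b) := by
    rintro (a | a) (b | b) hab
    · cases a <;> cases b
      · exact absurd rfl hab
      · exact hFF.symm
      · exact hFF
      · exact absurd rfl hab
    · exact hFT a b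
    · exact (hFT b a).symm
    · rw [Set.disjoint_left]
      rintro v ⟨h1, h2⟩ ⟨h3, -⟩
      have : v ∈ (T a).verts ∩ (T b).verts := ⟨h1, h3⟩
      rw [hTi a b fun h => hab (by rw [h])] at this
      exact h2 this
  refine connectsSet_of_connOn (fun a => K' (e a)) (fun a => U' (e a)) ?_ ?_ ?_ ?_
  · intro a
    rcases e a with _ | k
    · exact edgesOff_le _ _
    · exact SimpleGraph.Subgraph.spanningCoe_le _
  · intro a
    rcases e a with b | k
    · exact hF b
    · have : ((T k).verts \ S) ∪ S = (T k).verts := Set.sdiff_union_of_subset (hTS k)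
      simp only [K', U', Sum.elim_inr, this]
      rw [connOn_iff_induce_connected]
      convert (hT k).connected using 1
      ext u v
      simp
  · exact fun a b hab => hdisj _ _ fun h => hab (e.injective h)
  · intro a b hab u hu v hv h1 h2
    have hne : e a ≠ e b := fun h => hab (e.injective h)
    rcases ha : e a with k | k
    · simp only [ha] at h1
      exact h1.2 ⟨hu, hv⟩
    · rcases hb : e b with l | l
      · simp only [hb] at h2
        exact h2.2 ⟨hu, hv⟩
      · simp only [ha] at h1
        simp only [hb] at h2
        have h3 : s(u, v) ∈ (T k).edgeSet := by simpa [K'] using h1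
        have h4 : s(u, v) ∈ (T l).edgeSet := by simpa [K'] using h2
        exact Set.disjoint_left.1 (hTe k l fun h => hne (by rw [ha, hb, h])) h3 h4

/-- On at least three vertices, `κ₃(G) ≥ r` as soon as every triple is connected by `r`
internally disjoint trees. -/
theorem le_kappa3_of_forall_connectsSet {V : Type*} [Fintype V] {G : SimpleGraph V} {r : ℕ}
    (hV : 3 ≤ Fintype.card V)
    (h : ∀ S : Set V, S.ncard = 3 → ConnectsSet G S r) : r ≤ kappa3 G := by
  classical
  have hbdd : ∀ S : Set V, S.ncard = 3 → r ≤ treeConn G S := by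
    intro S hS
    refine le_csSup ⟨Nat.card (Sym2 V), ?_⟩ (h S hS)
    rintro n ⟨T, hT, hTS, -, hTe⟩
    have hedge : ∀ a, ∃ e, e ∈ (T a).edgeSet := by
      intro a
      obtain ⟨u, v, hu, hv, huv⟩ := (Set.one_lt_ncard_iff (Set.toFinite S)).1 (by omega)
      have hc : ConnOn (T a).coe Set.univ := by
        rw [connOn_iff_induce_connected, (SimpleGraph.induceUnivIso (T a).coe).connected_iff]
        exact (hT a).connected
      obtain ⟨t, -, w, -, -, hadj⟩ := hc.exists_adj_of_ssubset (Set.subset_univ _)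
        (Set.singleton_nonempty (⟨u, hTS a hu⟩ : (T a).verts)) (fun hsub => huv (by
          have := hsub (Set.mem_univ ⟨v, hTS a hv⟩)
          exact (congrArg Subtype.val (Set.mem_singleton_iff.1 this)).symm))
      exact ⟨s((t : V), (w : V)), hadj⟩
    choose e he using hedge
    have hinj : Function.Injective e := by
      intro a b hab
      by_contra hne
      exact Set.disjoint_left.1 (hTe a b hne) (he a) (hab ▸ he b)
    simpa using Nat.card_le_card_of_injective e hinj
  obtain ⟨S, -, hS⟩ := Set.exists_subset_card_eq (s := (Set.univ : Set V)) (n := 3)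
    (by simpa [Set.ncard_univ] using hV)
  refine le_csInf ⟨_, S, hS, rfl⟩ ?_
  rintro k ⟨S, hS, rfl⟩
  exact hbdd S hS

/-- The `i`-th part of the vertex set. -/
def cell {V : Type*} {p : ℕ} (part : V → Fin p) (i : Fin p) : Set V := {v | part v = i}

/-- The union of the parts with index in `J`. -/
def cells {V : Type*} {p : ℕ} (part : V → Fin p) (J : Set (Fin p)) : Set V := {v | part v ∈ J}

/-- `w` is an outside neighbour of `v`. -/
def OutAdj {V : Type*} {p : ℕ} (G : SimpleGraph V) (part : V → Fin p) (v w : V) : Prop :=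
  G.Adj v w ∧ part w ≠ part v

/-- The structural properties of a graph composed of `p` highly connected parts in which every
vertex has two outside neighbours. -/
structure IsComposed {V : Type*} {p : ℕ} (G : SimpleGraph V) (part : V → Fin p) (m : ℕ) :
    Prop where
  four_le : 4 ≤ m
  seven_le : 7 ≤ p
  inner : ∀ v, {w | G.Adj v w ∧ part w = part v}.ncard = m
  conn : ∀ i (X : Set V), X.ncard < m → ConnOn G (cell part i \ X)
  out : ∀ v, ∃ w₁ w₂, OutAdj G part v w₁ ∧ OutAdj G part v w₂ ∧ part w₁ ≠ part w₂ ∧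
    ∀ w, OutAdj G part v w → w = w₁ ∨ w = w₂
  cross : ∀ i j, i ≠ j → m + 2 ≤ {e : V × V | G.Adj e.1 e.2 ∧ part e.1 = i ∧ part e.2 = j}.ncard

/-- Disjoint connected subsets `L w` of `D`, each containing `w ∈ W` and touching `z`. -/
structure IsFan {V : Type*} (G : SimpleGraph V) (z : V) (D W : Set V) (L : V → Set V) : Prop where
  disj : ∀ v ∈ W, ∀ w ∈ W, v ≠ w → Disjoint (L v) (L w)
  conn : ∀ w ∈ W, ConnOn G (L w)
  sub : ∀ w ∈ W, L w ⊆ D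
  mem : ∀ w ∈ W, w ∈ L w
  touches : ∀ w ∈ W, Touches G z (L w)

namespace IsComposed

variable {V : Type*} {p m : ℕ} {G : SimpleGraph V} {part : V → Fin p}

theorem exists_other_out (h : IsComposed G part m) {v w : V} (hw : OutAdj G part v w) :
    ∃ w', OutAdj G part v w' ∧ part w' ≠ part w ∧ ∀ u, OutAdj G part v u → u = w ∨ u = w' := by
  obtain ⟨w₁, w₂, h1, h2, h3, h4⟩ := h.out v
  rcases h4 w hw with rfl | rfl
  · exact ⟨w₂, h2, h3.symm, h4⟩
  · exact ⟨w₁, h1, h3, fun u hu => (h4 u hu).symm⟩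

theorem out_unique (h : IsComposed G part m) {v w w' : V} (hw : OutAdj G part v w)
    (hw' : OutAdj G part v w') (hp : part w' = part w) : w' = w := by
  obtain ⟨u, -, hu, hall⟩ := h.exists_other_out hw
  rcases hall w' hw' with rfl | rfl
  · rfl
  · exact absurd hp hu

theorem _root_.OutAdj.symm {v w : V} (hw : OutAdj G part v w) : OutAdj G part w v :=
  ⟨hw.1.symm, hw.2.symm⟩

theorem le_cross_avoid [Finite V] (h : IsComposed G part m) {i j : Fin p} (hij : i ≠ j)
    (X : Set V) : m + 2 ≤ {e : V × V | G.Adj e.1 e.2 ∧ part e.1 = i ∧ part e.2 = j ∧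
      e.1 ∉ X ∧ e.2 ∉ X}.ncard + X.ncard := by
  classical
  set E := {e : V × V | G.Adj e.1 e.2 ∧ part e.1 = i ∧ part e.2 = j} with hE
  set F := {e : V × V | G.Adj e.1 e.2 ∧ part e.1 = i ∧ part e.2 = j ∧ e.1 ∉ X ∧ e.2 ∉ X} with hF
  have h1 : m + 2 ≤ E.ncard := h.cross i j hij
  have h2 : E.ncard ≤ F.ncard + (E \ F).ncard := by
    have : E ⊆ F ∪ (E \ F) := by simp
    exact (Set.ncard_le_ncard this (Set.toFinite _)).trans (Set.ncard_union_le _ _)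
  have h3 : (E \ F).ncard ≤ X.ncard := by
    refine Set.ncard_le_ncard_of_injOn (fun e => if e.1 ∈ X then e.1 else e.2) ?_ ?_
      (Set.toFinite _)
    · rintro ⟨a, b⟩ ⟨⟨k1, k2, k3⟩, k4⟩
      simp only [hF, Set.mem_ofPred_eq, not_and, not_not] at k4
      by_cases ha : a ∈ X
      · simp [ha]
      · simpa [ha] using k4 k1 k2 k3 ha
    · rintro ⟨a, b⟩ ⟨⟨k1, k2, k3⟩, -⟩ ⟨c, d⟩ ⟨⟨l1, l2, l3⟩, -⟩ hac
      simp only at k1 k2 k3 l1 l2 l3 hac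
      have kab : OutAdj G part a b := ⟨k1, by rw [k2, k3]; exact hij.symm⟩
      have lcd : OutAdj G part c d := ⟨l1, by rw [l2, l3]; exact hij.symm⟩
      split_ifs at hac with m1 m2 m2
      · subst hac
        rw [h.out_unique kab lcd (l3.trans k3.symm)]
      · exact absurd (by rw [← k2, hac, l3]) hij
      · exact absurd (by rw [← l2, ← hac, k3]) hij
      · subst hac
        rw [h.out_unique kab.symm lcd.symm (l2.trans k2.symm)]
  omega

theorem exists_cross_avoid [Finite V] (h : IsComposed G part m) {i j : Fin p} (hij : i ≠ j)
    {X : Set V} (hX : X.ncard ≤ m + 1) :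
    ∃ u v, OutAdj G part u v ∧ part u = i ∧ part v = j ∧ u ∉ X ∧ v ∉ X := by
  have h1 := h.le_cross_avoid hij X
  obtain ⟨⟨u, v⟩, k1, k2, k3, k4, k5⟩ := (Set.ncard_pos (Set.toFinite _)).1
    (show 0 < {e : V × V | G.Adj e.1 e.2 ∧ part e.1 = i ∧ part e.2 = j ∧
      e.1 ∉ X ∧ e.2 ∉ X}.ncard by omega)
  exact ⟨u, v, ⟨k1, by rw [k2, k3]; exact hij.symm⟩, k2, k3, k4, k5⟩

theorem conn_inter [Finite V] (h : IsComposed G part m) (i : Fin p) {X : Set V}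
    (hX : (X ∩ cell part i).ncard < m) : ConnOn G (cell part i \ X) := by
  have := h.conn i _ hX
  rwa [Set.sdiff_inter, Set.sdiff_self, Set.union_empty] at this

theorem connOn_cells_diff [Finite V] (h : IsComposed G part m) {J : Set (Fin p)}
    (hJ : J.Nonempty) {X : Set V} (hX : X.ncard ≤ m + 1)
    (hXJ : ∀ c ∈ J, (X ∩ cell part c).ncard < m) : ConnOn G (cells part J \ X) := by
  have hsub : ∀ c ∈ J, cell part c \ X ⊆ cells part J \ X := by
    rintro c hc v ⟨hv, hvX⟩
    exact ⟨by simpa [cells, show part v = c from hv] using hc, hvX⟩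
  refine ⟨?_, fun Z hZ hne hcl => ?_⟩
  · obtain ⟨c, hc⟩ := hJ
    exact (h.conn_inter c (hXJ c hc)).1.mono (hsub c hc)
  · have key : ∀ c ∈ J, (Z ∩ cell part c).Nonempty → cell part c \ X ⊆ Z := by
      rintro c hc ⟨v, hv, hvc⟩
      exact (h.conn_inter c (hXJ c hc)).subset_of_closed ⟨v, ⟨hvc, (hZ hv).2⟩, hv⟩
        fun a ha b hb hab => hcl a ha b (hsub c hc hb) hab
    obtain ⟨z, hz⟩ := hne
    have hzJ : part z ∈ J := (hZ hz).1
    have hz' := key _ hzJ ⟨z, hz, rfl⟩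
    rintro v ⟨hvJ, hvX⟩
    by_cases hvz : part z = part v
    · exact hz' ⟨hvz.symm, hvX⟩
    · obtain ⟨a, b, hab, ha, hb, haX, hbX⟩ := h.exists_cross_avoid hvz hX
      have hbZ : b ∈ Z := hcl a (hz' ⟨ha, haX⟩) b (hsub _ hvJ ⟨hb, hbX⟩) hab.1
      exact key _ hvJ ⟨b, hbZ, hb⟩ ⟨rfl, hvX⟩

/-- A fan inside a part, covering the part. -/
theorem exists_fan_cell [Finite V] {ι : Type*} [Fintype ι] [Nonempty ι]
    (h : IsComposed G part m) {i : Fin p} {x : V} (hx : part x = i) (T : ι → V)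
    (hT : Function.Injective T) (hTi : ∀ k, part (T k) = i) (hTx : ∀ k, T k ≠ x)
    (hcard : Fintype.card ι ≤ m) :
    ∃ C : ι → Set V, (Pairwise fun k l => Disjoint (C k) (C l)) ∧
      (∀ k, ConnOn G (C k) ∧ C k ⊆ cell part i \ {x} ∧ T k ∈ C k ∧ Touches G x (C k)) ∧
      ∀ v ∈ cell part i \ {x}, ∃ k, v ∈ C k := by
  have hm := h.four_le
  obtain ⟨C, hd, hC⟩ := exists_fan_within G (cell part i \ {x}) x T (by
    intro Z hZ X hX hlt hdisj hN hcl
    obtain ⟨k, hk⟩ : ∃ k, T k ∉ X := by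
      by_contra hcon
      push Not at hcon
      have : (Set.range T).ncard ≤ X.ncard :=
        Set.ncard_le_ncard (by rintro _ ⟨k, rfl⟩; exact hcon k) (Set.toFinite _)
      rw [← Set.image_univ, Set.ncard_image_of_injective _ hT, Set.ncard_univ,
        Nat.card_eq_fintype_card] at this
      omega
    refine ⟨k, ?_⟩
    have hxX : x ∉ X := fun hxX => (hX hxX).2 rfl
    have hsub : cell part i \ X ⊆ insert x Z :=
      (h.conn i X (by omega)).subset_of_closed ⟨x, ⟨hx, hxX⟩, Or.inl rfl⟩ (by
        rintro v hv w ⟨hw, hwX⟩ hvw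
        by_cases hwx : w = x
        · exact Or.inl hwx
        · rcases hv with rfl | hv
          · exact Or.inr ((hN w ⟨hw, hwx⟩ hvw).resolve_right hwX)
          · exact Or.inr ((hcl v hv w ⟨hw, hwx⟩ hvw).resolve_right hwX))
    exact (hsub ⟨hTi k, hk⟩).resolve_left (hTx k))
  obtain ⟨C', h1, h2, h3, h4, h5⟩ := (h.conn i {x} (by simp; omega)).exists_cover C
    (fun k => (hC k).1) (fun k => (hC k).2.1) hd
  exact ⟨C', h4, fun k => ⟨h2 k, h3 k, h1 k (hC k).2.2.1, (hC k).2.2.2.mono (h1 k)⟩, h5⟩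

/-- Disjoint connected sets joining two vertices of a part inside the part, covering the part. -/
theorem exists_links_cell [Finite V] (h : IsComposed G part m) {i : Fin p} {x y : V}
    (hx : part x = i) (hy : part y = i) (hxy : x ≠ y) {k : ℕ} (hk : k ≤ m)
    (hk' : G.Adj x y → k + 1 ≤ m) (hk0 : 0 < k) :
    ∃ Q : Fin k → Set V, (Pairwise fun k l => Disjoint (Q k) (Q l)) ∧
      (∀ l, ConnOn G (Q l) ∧ Q l ⊆ cell part i \ {x, y} ∧ Touches G x (Q l) ∧
        Touches G y (Q l)) ∧
      ∀ v ∈ cell part i \ {x, y}, ∃ l, v ∈ Q l := by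
  have hm := h.four_le
  obtain ⟨C, hd, hC⟩ := exists_disjoint_connOn_within G (cell part i \ {x, y})
    {v ∈ cell part i \ {x, y} | G.Adj x v} {v | G.Adj y v} k (fun v hv => hv.1) (by
    intro Z hZ X hX hlt hdisj hN hcl
    have hxX : x ∉ X := fun hxX => (hX hxX).2 (Or.inl rfl)
    have hyX : y ∉ X := fun hyX => (hX hyX).2 (Or.inr rfl)
    have step : ∀ v ∈ insert x Z, ∀ w ∈ cell part i \ X, w ≠ y → G.Adj v w → w ∈ insert x Z := by
      rintro v hv w ⟨hw, hwX⟩ hwy hvw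
      by_cases hwx : w = x
      · exact Or.inl hwx
      · have hwD : w ∈ cell part i \ {x, y} := ⟨hw, by simp [hwx, hwy]⟩
        rcases hv with rfl | hv
        · exact Or.inr ((hN ⟨hwD, hvw⟩).resolve_right hwX)
        · exact Or.inr ((hcl v hv w hwD hvw).resolve_right hwX)
    by_cases hadj : G.Adj x y
    · have hlt' : (insert y X).ncard < m := by
        have := Set.ncard_insert_le y X
        have := hk' hadj
        omega
      have hsub : cell part i \ insert y X ⊆ insert x Z :=
        (h.conn i _ hlt').subset_of_closed ⟨x, ⟨hx, by simp [hxy, hxX]⟩, Or.inl rfl⟩ (by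
          rintro v hv w ⟨hw, hwX⟩ hvw
          exact step v hv w ⟨hw, fun h => hwX (Or.inr h)⟩ (fun h => hwX (Or.inl h)) hvw)
      have hlt'' : (insert x X).ncard < {w | G.Adj y w ∧ part w = part y}.ncard := by
        rw [h.inner y]
        have := Set.ncard_insert_le x X
        have := hk' hadj
        omega
      obtain ⟨b, hb, hbX⟩ := Set.exists_mem_notMem_of_ncard_lt_ncard hlt'' (Set.toFinite _)
      have hbx : b ≠ x := fun h => hbX (Or.inl h)
      refine ⟨b, (hsub ⟨hb.2.trans hy, ?_⟩).resolve_left hbx, hb.1⟩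
      rintro (h | h)
      · exact hb.1.ne h.symm
      · exact hbX (Or.inr h)
    · by_contra hcon
      have hcon' : ∀ b ∈ Z, ¬ G.Adj y b := fun b hb hyb => hcon ⟨b, hb, hyb⟩
      have hsub : cell part i \ X ⊆ insert x Z :=
        (h.conn i X (by omega)).subset_of_closed ⟨x, ⟨hx, hxX⟩, Or.inl rfl⟩ (by
          rintro v hv w hw hvw
          refine step v hv w hw ?_ hvw
          rintro rfl
          rcases hv with rfl | hv
          · exact hadj hvw
          · exact hcon' v hv hvw.symm)
      rcases hsub ⟨hy, hyX⟩ with h1 | h1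
      · exact hxy h1.symm
      · exact (hZ h1).2 (Or.inr rfl))
  have : Nonempty (Fin k) := ⟨⟨0, hk0⟩⟩
  obtain ⟨C', h1, h2, h3, h4, h5⟩ := (h.conn i {x, y} (by
    rw [Set.ncard_pair hxy]; omega)).exists_cover C (fun k => (hC k).1) (fun k => (hC k).2.1) hd
  refine ⟨C', h4, fun k => ⟨h2 k, h3 k, ?_, ?_⟩, h5⟩
  · obtain ⟨u, hu, hu'⟩ := (hC k).2.2.1
    exact ⟨u, h1 k hu, hu'.2⟩
  · obtain ⟨u, hu, hu'⟩ := (hC k).2.2.2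
    exact ⟨u, h1 k hu, hu'⟩

/-- A fan from `z` in the complement of some parts. -/
theorem exists_fan_cells [Finite V] (h : IsComposed G part m) {J : Set (Fin p)} {z : V}
    (hz : part z ∈ J) {t : ℕ} (ht : t ≤ 2) {W : Set V} (hWJ : W ⊆ cells part J \ {z})
    (hW : W.ncard = m + t) (hWt : ∀ c, t ≤ (W \ cell part c).ncard)
    {O : Set V} (hO : t ≤ O.ncard) (hzO : ∀ w ∈ O, OutAdj G part z w ∧ part w ∈ J) :
    ∃ L : V → Set V, IsFan G z (cells part J \ {z}) W L := by
  classical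
  have hm := h.four_le
  have : Fintype W := Fintype.ofFinite W
  obtain ⟨C, hd, hC⟩ := exists_fan_within G (cells part J \ {z}) z (fun w : W => (w : V)) (by
    intro Z hZ X hX hlt hdisj hN hcl
    rw [← Nat.card_eq_fintype_card, Nat.card_coe_set_eq, hW] at hlt
    have hzX : z ∉ X := fun h => (hX h).2 rfl
    have split : ∀ c, (X ∩ cell part c).ncard + (X \ cell part c).ncard = X.ncard := fun c =>
      Set.ncard_inter_add_ncard_sdiff_eq_ncard X (cell part c) (Set.toFinite _)
    have bad_unique : ∀ c d, m ≤ (X ∩ cell part c).ncard → m ≤ (X ∩ cell part d).ncard →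
        c = d := by
      intro c d hc hdd
      by_contra hcd
      have : X ∩ cell part d ⊆ X \ cell part c := fun v hv =>
        ⟨hv.1, fun hvc => hcd (hvc.symm.trans hv.2)⟩
      have := Set.ncard_le_ncard this (Set.toFinite _)
      have := split c
      omega
    set J' : Set (Fin p) := {c ∈ J | (X ∩ cell part c).ncard < m} with hJ'
    have hstep : ∀ v ∈ insert z Z, ∀ w ∈ cells part J, w ∉ X → G.Adj v w → w ∈ insert z Z := by
      intro v hv w hw hwX hvw
      by_cases hwz : w = z
      · exact Or.inl hwz
      · rcases hv with rfl | hv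
        · exact Or.inr ((hN w ⟨hw, hwz⟩ hvw).resolve_right hwX)
        · exact Or.inr ((hcl v hv w ⟨hw, hwz⟩ hvw).resolve_right hwX)
    have hmeet : ∃ u, u ∈ insert z Z ∧ part u ∈ J' ∧ u ∉ X := by
      by_cases hgood : (X ∩ cell part (part z)).ncard < m
      · exact ⟨z, Or.inl rfl, ⟨hz, hgood⟩, hzX⟩
      · push Not at hgood
        have hlt' : (X \ cell part (part z)).ncard < O.ncard := by
          have := split (part z)
          omega
        obtain ⟨u, huO, hu⟩ := Set.exists_mem_notMem_of_ncard_lt_ncard hlt' (Set.toFinite _)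
        obtain ⟨hzu, huJ⟩ := hzO u huO
        have huX : u ∉ X := fun hX => hu ⟨hX, hzu.2⟩
        refine ⟨u, hstep z (Or.inl rfl) u huJ huX hzu.1, ⟨huJ, ?_⟩, huX⟩
        by_contra hbad
        push Not at hbad
        exact hzu.2 (bad_unique _ _ hbad hgood)
    obtain ⟨u, huZ, huJ, huX⟩ := hmeet
    have hsub : cells part J' \ X ⊆ insert z Z :=
      (h.connOn_cells_diff ⟨_, huJ⟩ (by omega) fun c hc => hc.2).subset_of_closed
        ⟨u, ⟨huJ, huX⟩, huZ⟩ fun v hv w hw hvw => hstep v hv w hw.1.1 hw.2 hvw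
    have hsurv : ∃ w ∈ W, w ∉ X ∧ part w ∈ J' := by
      by_cases hbad : ∃ c, m ≤ (X ∩ cell part c).ncard
      · obtain ⟨c, hc⟩ := hbad
        have hlt' : (X \ cell part c).ncard < (W \ cell part c).ncard := by
          have := split c
          have := hWt c
          omega
        obtain ⟨w, hw, hwX⟩ := Set.exists_mem_notMem_of_ncard_lt_ncard hlt' (Set.toFinite _)
        refine ⟨w, hw.1, fun h => hwX ⟨h, hw.2⟩, (hWJ hw.1).1, ?_⟩
        by_contra hbad
        push Not at hbad
        exact hw.2 (bad_unique _ _ hbad hc)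
      · push Not at hbad
        obtain ⟨w, hw, hwX⟩ := Set.exists_mem_notMem_of_ncard_lt_ncard (s := X) (t := W)
          (by omega) (Set.toFinite _)
        exact ⟨w, hw, hwX, (hWJ hw).1, hbad _⟩
    obtain ⟨w, hw, hwX, hwJ⟩ := hsurv
    exact ⟨⟨w, hw⟩, (hsub ⟨hwJ, hwX⟩).resolve_left (hWJ hw).2⟩)
  have hL : ∀ w (hw : w ∈ W), (if hw : w ∈ W then C ⟨w, hw⟩ else ∅) = C ⟨w, hw⟩ :=
    fun w hw => by simp only [hw, dif_pos]
  refine ⟨fun v => if hv : v ∈ W then C ⟨v, hv⟩ else ∅, fun v hv w hw hvw => ?_, fun w hw => ?_,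
    fun w hw => ?_, fun w hw => ?_, fun w hw => ?_⟩
  · rw [hL v hv, hL w hw]
    exact hd fun h => hvw (congrArg Subtype.val h)
  all_goals rw [hL w hw]
  · exact (hC _).1
  · exact (hC _).2.1
  · exact (hC ⟨w, hw⟩).2.2.1
  · exact (hC _).2.2.2

end IsComposed

/-- Disjoint connected sets avoiding the parts with index in `J`, each touching both of the
vertices `x` and `y` outside these parts. -/
structure IsLinkFamily {V κ : Type*} {p : ℕ} (G : SimpleGraph V) (part : V → Fin p)
    (J : Set (Fin p)) (x y : V) (Q : κ → Set V) : Prop where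
  left_notMem : part x ∉ J
  mid_notMem : part y ∉ J
  conn : ∀ k, ConnOn G (Q k)
  off : ∀ k, Disjoint (Q k) (cells part J)
  left_off : ∀ k, x ∉ Q k
  mid_off : ∀ k, y ∉ Q k
  disj : Pairwise fun k l => Disjoint (Q k) (Q l)
  left : ∀ k, Touches G x (Q k)
  mid : ∀ k, Touches G y (Q k)

/-- The sets `Q k` extend to sets touching `x`, `y` and `z`, leaving room for a fan from `z` to
`E` in the parts with index in `J`. -/
def ExtendsToUnits {V κ : Type*} {p : ℕ} (G : SimpleGraph V) (part : V → Fin p)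
    (J : Set (Fin p)) (x y z : V) (Q : κ → Set V) (E : Set V) : Prop :=
  ∃ (U : κ → Set V) (L : V → Set V), IsUnitFamily G x y z U ∧
    IsFan G z (cells part J \ {z}) E L ∧ (∀ w ∈ E, ∀ k, Disjoint (L w) (U k)) ∧
    ∀ D : Set V, Disjoint D (cells part J) → (∀ k, Disjoint D (Q k)) → ∀ k, Disjoint D (U k)

section Attach

variable {V κ : Type*} {p m : ℕ} {G : SimpleGraph V} {part : V → Fin p} {J : Set (Fin p)}
  {x y z : V} {Q : κ → Set V} {E : Set V}

theorem IsLinkFamily.extendsToUnits (hQ : IsLinkFamily G part J x y Q) (hz : part z ∈ J)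
    {f : κ → V} {N : Set κ} {L : V → Set V}
    (hL : IsFan G z (cells part J \ {z}) (f '' Nᶜ ∪ E) L)
    (hN : ∀ k ∈ N, Touches G z (Q k)) (hf : ∀ k ∉ N, Touches G (f k) (Q k))
    (hinj : Set.InjOn f Nᶜ) (hfE : ∀ k ∉ N, f k ∉ E) :
    ExtendsToUnits G part J x y z Q E := by
  classical
  let R : κ → Set V := fun k => if k ∈ N then ∅ else L (f k)
  have hRN : ∀ k ∈ N, R k = ∅ := fun k hk => by simp [R, hk]
  have hR : ∀ k ∉ N, R k = L (f k) := fun k hk => by simp [R, hk]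
  have hmem : ∀ k ∉ N, f k ∈ f '' Nᶜ ∪ E := fun k hk => Or.inl ⟨k, hk, rfl⟩
  have hRsub : ∀ k, R k ⊆ cells part J \ {z} := by
    intro k
    by_cases hk : k ∈ N
    · simp [hRN k hk]
    · rw [hR k hk]
      exact hL.sub _ (hmem k hk)
  have hQR : ∀ k l, Disjoint (Q k) (R l) := fun k l =>
    (hQ.off k).mono_right ((hRsub l).trans Set.sdiff_subset)
  refine ⟨fun k => Q k ∪ R k, L, ⟨fun k => ?_, fun k => ?_, fun k l hkl => ?_,
    fun k => (hQ.left k).mono Set.subset_union_left,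
    fun k => (hQ.mid k).mono Set.subset_union_left, fun k => ?_⟩,
    ⟨fun v hv w hw => hL.disj v (Or.inr hv) w (Or.inr hw), fun w hw => hL.conn w (Or.inr hw),
      fun w hw => hL.sub w (Or.inr hw), fun w hw => hL.mem w (Or.inr hw),
      fun w hw => hL.touches w (Or.inr hw)⟩, fun w hw k => ?_, fun D hD hDQ k => ?_⟩
  · by_cases hk : k ∈ N
    · simpa [hRN k hk] using hQ.conn k
    · rw [hR k hk]
      obtain ⟨u, hu, hfu⟩ := hf k hk
      exact (hQ.conn k).union (hL.conn _ (hmem k hk))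
        ⟨u, hu, f k, hL.mem _ (hmem k hk), Or.inr hfu.symm⟩
  · rw [Set.disjoint_left]
    rintro v (hv | hv) hv'
    · simp only [Set.mem_insert_iff, Set.mem_singleton_iff] at hv'
      rcases hv' with rfl | rfl | rfl
      · exact hQ.left_off k hv
      · exact hQ.mid_off k hv
      · exact Set.disjoint_left.1 (hQ.off k) hv hz
    · obtain ⟨h1, h2⟩ := hRsub k hv
      simp only [Set.mem_insert_iff, Set.mem_singleton_iff] at hv'
      rcases hv' with rfl | rfl | rfl
      · exact hQ.left_notMem h1
      · exact hQ.mid_notMem h1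
      · exact h2 rfl
  · refine Set.disjoint_union_left.2 ⟨Set.disjoint_union_right.2 ⟨hQ.disj hkl, hQR k l⟩,
      Set.disjoint_union_right.2 ⟨(hQR l k).symm, ?_⟩⟩
    by_cases hk : k ∈ N
    · simp [hRN k hk]
    · by_cases hl : l ∈ N
      · simp [hRN l hl]
      · rw [hR k hk, hR l hl]
        exact hL.disj _ (hmem k hk) _ (hmem l hl) fun h => hkl (hinj hk hl h)
  · by_cases hk : k ∈ N
    · exact (hN k hk).mono Set.subset_union_left
    · rw [hR k hk]
      exact (hL.touches _ (hmem k hk)).mono Set.subset_union_right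
  · refine Set.disjoint_union_right.2 ⟨?_, ?_⟩
    · exact ((hQ.off k).mono_right ((hL.sub w (Or.inr hw)).trans Set.sdiff_subset)).symm
    · by_cases hk : k ∈ N
      · simp [hRN k hk]
      · rw [hR k hk]
        exact hL.disj _ (Or.inr hw) _ (hmem k hk) fun h => hfE k hk (h ▸ hw)
  · exact Set.disjoint_union_right.2 ⟨hDQ k,
      hD.mono_right ((hRsub k).trans Set.sdiff_subset)⟩

theorem ncard_image_compl_union_add [Finite V] [Fintype κ] {f : κ → V} {N : Set κ}
    (hinj : Set.InjOn f Nᶜ) (hfE : ∀ k ∉ N, f k ∉ E) :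
    (f '' Nᶜ ∪ E).ncard + N.ncard = Fintype.card κ + E.ncard := by
  rw [Set.ncard_union_eq (by
    rw [Set.disjoint_left]
    rintro _ ⟨k, hk, rfl⟩
    exact hfE k hk) (Set.toFinite _) (Set.toFinite _), Set.InjOn.ncard_image hinj,
    ← Nat.card_eq_fintype_card, ← Set.ncard_add_ncard_compl N]
  omega

/-- Representatives `v k ∈ Q k` in the part `i` with outside neighbours `f k ∉ E` in the parts
with index in `J`. -/
structure IsReps (G : SimpleGraph V) (part : V → Fin p) (J : Set (Fin p)) (i : Fin p)
    (Q : κ → Set V) (E : Set V) (v f : κ → V) : Prop where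
  mem : ∀ k, v k ∈ Q k
  part_eq : ∀ k, part (v k) = i
  out : ∀ k, OutAdj G part (v k) (f k)
  target_mem : ∀ k, part (f k) ∈ J
  notMem : ∀ k, f k ∉ E

namespace IsReps

variable {i : Fin p} {v f : κ → V}

theorem touches (hr : IsReps G part J i Q E v f) (k : κ) : Touches G (f k) (Q k) :=
  ⟨v k, hr.mem k, (hr.out k).1.symm⟩

theorem injective (hr : IsReps G part J i Q E v f) (h : IsComposed G part m)
    (hd : Pairwise fun k l => Disjoint (Q k) (Q l)) : Function.Injective f := by
  intro k l hkl
  by_contra hne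
  have h1 := (hr.out k).symm
  have h2 := (hr.out l).symm
  rw [← hkl] at h2
  have h3 := h.out_unique h1 h2 ((hr.part_eq l).trans (hr.part_eq k).symm)
  exact Set.disjoint_left.1 (hd hne) (hr.mem k) (h3 ▸ hr.mem l)

theorem exists_two_parts [Finite V] [Nontrivial κ] (hr : IsReps G part J i Q E v f)
    (h : IsComposed G part m) (hi : i ∉ J) (hJ : Jᶜ.ncard ≤ 2) {F : Set V} (hF : F.ncard ≤ 2)
    (hcov : ∀ g, part g = i → g ∉ F → ∃ k, g ∈ Q k) {e : V}
    (hE : ∀ w ∈ E, w ≠ e → ∀ g, part g = i → OutAdj G part g w → g ∈ F) :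
    ∃ v' f' : κ → V, IsReps G part J i Q E v' f' ∧ ∃ k l, part (f' k) ≠ part (f' l) := by
  classical
  by_cases hex : ∃ k l, part (f k) ≠ part (f l)
  · exact ⟨v, f, hr, hex⟩
  · push Not at hex
    obtain ⟨k₀, l₀, -⟩ := exists_pair_ne κ
    have hlt : (Jᶜ ∪ {part (f k₀), part e}).ncard < (Set.univ : Set (Fin p)).ncard := by
      have h1 := Set.ncard_union_le Jᶜ {part (f k₀), part e}
      have h2 := Set.ncard_insert_le (part (f k₀)) {part e}
      rw [Set.ncard_singleton] at h2
      have := h.seven_le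
      rw [Set.ncard_univ, Nat.card_fin]
      omega
    obtain ⟨d, -, hd⟩ := Set.exists_mem_notMem_of_ncard_lt_ncard hlt (Set.toFinite _)
    have hdJ : d ∈ J := by
      by_contra hdJ
      exact hd (Or.inl hdJ)
    have hdf : d ≠ part (f k₀) := fun h => hd (Or.inr (Or.inl h))
    have hde : d ≠ part e := fun h => hd (Or.inr (Or.inr h))
    have hm := h.four_le
    obtain ⟨g, n, hgn, hg, hn, hgF, -⟩ := h.exists_cross_avoid (i := i) (j := d)
      (fun h => hi (h ▸ hdJ)) (X := F) (by omega)
    obtain ⟨k, hk⟩ := hcov g hg hgF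
    obtain ⟨l, hl⟩ := exists_ne k
    refine ⟨Function.update v k g, Function.update f k n, ⟨?_, ?_, ?_, ?_, ?_⟩, k, l, ?_⟩
    · intro a
      by_cases ha : a = k
      · subst ha; simpa using hk
      · simpa [ha] using hr.mem a
    · intro a
      by_cases ha : a = k
      · subst ha; simpa using hg
      · simpa [ha] using hr.part_eq a
    · intro a
      by_cases ha : a = k
      · subst ha; simpa using hgn
      · simpa [ha] using hr.out a
    · intro a
      by_cases ha : a = k
      · subst ha; simpa [hn] using hdJ
      · simpa [ha] using hr.target_mem a
    · intro a
      by_cases ha : a = k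
      · subst ha
        simp only [Function.update_self]
        intro hnE
        exact hgF (hE n hnE (fun h => hde (by rw [← h, hn])) g hg hgn)
      · simpa [ha] using hr.notMem a
    · simp only [Function.update_self, Function.update_of_ne hl, hn, hex l k₀]
      exact hdf

end IsReps

theorem two_le_ncard_diff_cell [Finite V] {W : Set V} {a b c d : V} (ha : a ∈ W) (hb : b ∈ W)
    (hc : c ∈ W) (hd : d ∈ W) (hab : part a ≠ part b) (hcd : part c ≠ part d) (hac : a ≠ c)
    (had : a ≠ d) (hbc : b ≠ c) (hbd : b ≠ d) (i : Fin p) : 2 ≤ (W \ cell part i).ncard := by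
  have key : ∀ s t, part s ≠ part t → ∃ u, (u = s ∨ u = t) ∧ u ∉ cell part i := by
    intro s t hst
    by_cases hs : part s = i
    · exact ⟨t, Or.inr rfl, fun ht => hst (hs.trans (show part t = i from ht).symm)⟩
    · exact ⟨s, Or.inl rfl, hs⟩
  obtain ⟨u, hu, hui⟩ := key a b hab
  obtain ⟨w, hw, hwi⟩ := key c d hcd
  have : 1 < (W \ cell part i).ncard := by
    rw [Set.one_lt_ncard_iff (Set.toFinite _)]
    refine ⟨u, w, ⟨?_, hui⟩, ⟨?_, hwi⟩, ?_⟩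
    · rcases hu with rfl | rfl <;> assumption
    · rcases hw with rfl | rfl <;> assumption
    · rcases hu with rfl | rfl <;> rcases hw with rfl | rfl <;> assumption
  omega

theorem one_le_ncard_diff_cell [Finite V] {W : Set V} {a b : V} (ha : a ∈ W) (hb : b ∈ W)
    (hab : part a ≠ part b) (i : Fin p) : 1 ≤ (W \ cell part i).ncard := by
  refine (Set.ncard_pos (Set.toFinite _)).2 ?_
  by_cases hs : part a = i
  · exact ⟨b, hb, fun ht => hab (hs.trans (show part b = i from ht).symm)⟩
  · exact ⟨a, ha, hs⟩

/-- If `z` has at most one outside neighbour in the parts hosting the links, and that neighbour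
lies on a link, then the links extend to units avoiding a set `E` of additional targets that
contains vertices of two distinct parts. -/
theorem IsLinkFamily.extendsToUnits_of_subsingleton [Finite V] [Fintype κ] [Nontrivial κ]
    (hQ : IsLinkFamily G part J x y Q) (h : IsComposed G part m) (hz : part z ∈ J)
    (hcard : Fintype.card κ + E.ncard = m + 2) {i : Fin p} (hi : i ∉ J) (hJ : Jᶜ.ncard ≤ 2)
    {F : Set V} (hF : F.ncard ≤ 2) (hcov : ∀ g, part g = i → g ∉ F → ∃ k, g ∈ Q k) {e : V}
    (hE : ∀ w ∈ E, w ≠ e → ∀ g, part g = i → OutAdj G part g w → g ∈ F)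
    {v f : κ → V} (hr : IsReps G part J i Q E v f) (hEJ : E ⊆ cells part J \ {z})
    {a b : V} (ha : a ∈ E) (hb : b ∈ E) (hab : part a ≠ part b)
    (hσ : ∀ u u', OutAdj G part z u → OutAdj G part z u' → part u ∉ J → part u' ∉ J → u = u')
    (hσQ : ∀ u, OutAdj G part z u → part u ∉ J → ∃ k, u ∈ Q k) :
    ExtendsToUnits G part J x y z Q E := by
  obtain ⟨o₁, o₂, ho₁, ho₂, ho, -⟩ := h.out z
  have hne : o₁ ≠ o₂ := fun h => ho (by rw [h])
  by_cases hex : ∃ u, OutAdj G part z u ∧ part u ∉ J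
  · obtain ⟨u, hzu, huJ⟩ := hex
    obtain ⟨k₀, hk₀⟩ := hσQ u hzu huJ
    obtain ⟨o, hzo, hoJ⟩ : ∃ o, OutAdj G part z o ∧ part o ∈ J := by
      by_contra hcon
      push Not at hcon
      exact hne (hσ o₁ o₂ ho₁ ho₂ (hcon _ ho₁) (hcon _ ho₂))
    have hinj := hr.injective h hQ.disj
    have hWcard := ncard_image_compl_union_add (f := f) (N := {k₀}) (E := E) hinj.injOn
      fun k _ => hr.notMem k
    rw [Set.ncard_singleton] at hWcard
    obtain ⟨L, hL⟩ := h.exists_fan_cells hz (t := 1) (by omega) (W := f '' {k₀}ᶜ ∪ E) (by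
        rintro _ (⟨k, hk, rfl⟩ | hw)
        · refine ⟨hr.target_mem k, fun hkz => hk ?_⟩
          have hkz : f k = z := hkz
          have h1 := (hr.out k).symm
          rw [hkz] at h1
          have h2 : v k = u := hσ _ _ h1 hzu (by rw [hr.part_eq]; exact hi) huJ
          by_contra hne
          exact Set.disjoint_left.1 (hQ.disj hne) (hr.mem k) (h2 ▸ hk₀)
        · exact hEJ hw) (by omega)
      (one_le_ncard_diff_cell (Or.inr ha) (Or.inr hb) hab) (O := {o}) (by simp) (by
        rintro w rfl
        exact ⟨hzo, hoJ⟩)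
    refine hQ.extendsToUnits hz hL ?_ (fun k _ => hr.touches k) hinj.injOn fun k _ => hr.notMem k
    rintro k rfl
    exact ⟨u, hk₀, hzu.1⟩
  · push Not at hex
    obtain ⟨v', f', hr', k, l, hkl⟩ := hr.exists_two_parts h hi hJ hF hcov hE
    have hinj := hr'.injective h hQ.disj
    have hWcard := ncard_image_compl_union_add (f := f') (N := ∅) (E := E) hinj.injOn
      fun k _ => hr'.notMem k
    rw [Set.ncard_empty] at hWcard
    have hfW : ∀ k, f' k ∈ f' '' ∅ᶜ ∪ E := fun k => Or.inl ⟨k, by simp, rfl⟩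
    have hfne : ∀ k, ∀ w ∈ E, w ≠ f' k := fun k w hw h => hr'.notMem k (h ▸ hw)
    obtain ⟨L, hL⟩ := h.exists_fan_cells hz (t := 2) (by omega) (W := f' '' ∅ᶜ ∪ E) (by
        rintro _ (⟨k, -, rfl⟩ | hw)
        · refine ⟨hr'.target_mem k, fun hkz => ?_⟩
          have hkz : f' k = z := hkz
          have h1 := (hr'.out k).symm
          rw [hkz] at h1
          exact hi (hr'.part_eq k ▸ hex _ h1)
        · exact hEJ hw) (by omega)
      (two_le_ncard_diff_cell (Or.inr ha) (Or.inr hb) (hfW k) (hfW l) hab hkl (hfne k a ha)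
        (hfne l a ha) (hfne k b hb) (hfne l b hb)) (O := {o₁, o₂}) (by
          rw [Set.ncard_pair hne]) (by
        rintro w (rfl | rfl)
        · exact ⟨ho₁, hex _ ho₁⟩
        · exact ⟨ho₂, hex _ ho₂⟩)
    exact hQ.extendsToUnits hz hL (by simp) (fun k _ => hr'.touches k) hinj.injOn
      fun k _ => hr'.notMem k

end Attach

section Finish

variable {V κ : Type*} {p m : ℕ} {G : SimpleGraph V} {part : V → Fin p} {J : Set (Fin p)}
  {x y z : V} {Q : κ → Set V} {E : Set V}

theorem ExtendsToUnits.connectsSet [Finite V] [Fintype κ]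
    (hX : ExtendsToUnits G part J x y z Q E) (D : Set V) (hD : Disjoint D (cells part J))
    (hDQ : ∀ k, Disjoint D (Q k))
    (hconn : ∀ L, IsFan G z (cells part J \ {z}) E L →
      ConnOn G (D ∪ (⋃ w ∈ E, L w) ∪ {x, y, z})) :
    ConnectsSet G {x, y, z} (Fintype.card κ + 1) := by
  obtain ⟨U, L, hU, hL, hLU, hext⟩ := hX
  refine hU.connectsSet (D ∪ ⋃ w ∈ E, L w) (hconn L hL) fun k => ?_
  refine Set.disjoint_union_left.2 ⟨hext D hD hDQ k, ?_⟩
  simp only [Set.disjoint_iUnion_left]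
  exact fun w hw => hLU w hw k

theorem ExtendsToUnits.connectsSet_of_hub [Finite V] [Fintype κ]
    (hX : ExtendsToUnits G part J x y z Q E) (hx : part x ∉ J) (hy : part y ∉ J) {a b : V}
    (ha : a ∈ E) (hb : b ∈ E) (hxa : G.Adj x a) (hyb : G.Adj y b)
    (hconn : ∀ L, IsFan G z (cells part J \ {z}) E L →
      ConnOn G ((⋃ w ∈ E \ {a, b}, L w) ∪ {x, y, z})) :
    ConnectsSet G {x, y, z} (Fintype.card κ + 2) := by
  obtain ⟨U, L, hU, hL, hLU, hext⟩ := hX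
  have hoff : ∀ w ∈ E, Disjoint (L w) {x, y, z} := by
    intro w hw
    rw [Set.disjoint_left]
    intro v hv hv'
    obtain ⟨h1, h2⟩ := hL.sub w hw hv
    simp only [Set.mem_insert_iff, Set.mem_singleton_iff] at hv'
    rcases hv' with rfl | rfl | rfl
    · exact hx h1
    · exact hy h1
    · exact h2 rfl
  refine hU.connectsSet_of_two (⋃ w ∈ E \ {a, b}, L w) (L a) (L b) (hconn L hL) (hL.conn a ha)
    (hL.conn b hb) (hoff a ha) (hoff b hb) ⟨a, hL.mem a ha, hxa⟩ (hL.touches a ha)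
    ⟨b, hL.mem b hb, hyb⟩ (hL.touches b hb) ?_ ?_ ?_
  · simp only [Set.disjoint_iUnion_left]
    rintro w ⟨hw, hwab⟩
    simp only [Set.mem_insert_iff, Set.mem_singleton_iff, not_or] at hwab
    exact Set.disjoint_union_right.2 ⟨hL.disj w hw a ha hwab.1, hL.disj w hw b hb hwab.2⟩
  · intro k
    simp only [Set.disjoint_iUnion_left]
    exact fun w hw => hLU w hw.1 k
  · exact fun k => Set.disjoint_union_left.2 ⟨hLU a ha k, hLU b hb k⟩

theorem ExtendsToUnits.connectsSet_of_pair [Finite V] [Fintype κ] {a b : V}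
    (hX : ExtendsToUnits G part J x y z Q {a, b}) (hxa : G.Adj x a) (hyb : G.Adj y b) :
    ConnectsSet G {x, y, z} (Fintype.card κ + 1) := by
  refine hX.connectsSet ∅ (by simp) (by simp) fun L hL => ?_
  have ha : a ∈ ({a, b} : Set V) := Or.inl rfl
  have hb : b ∈ ({a, b} : Set V) := Or.inr rfl
  have := (hL.conn a ha).union_two_triple ⟨a, hL.mem a ha, hxa⟩ (hL.touches a ha)
    (hL.conn b hb) ⟨b, hL.mem b hb, hyb⟩ (hL.touches b hb)
  simpa [Set.biUnion_pair] using this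

theorem IsLinkFamily.extendsToUnits_of_reps [Finite V] [Fintype κ]
    (hQ : IsLinkFamily G part J x y Q) (h : IsComposed G part m) (hz : part z ∈ J) {i : Fin p}
    {v f : κ → V} (hr : IsReps G part J i Q E v f) (hEJ : E ⊆ cells part J \ {z}) {N : Set κ}
    (hN : ∀ k ∈ N, Touches G z (Q k)) (hfz : ∀ k ∉ N, f k ≠ z) {t : ℕ} (ht : t ≤ 2)
    (hcard : Fintype.card κ + E.ncard = m + t + N.ncard)
    (hWt : ∀ c, t ≤ ((f '' Nᶜ ∪ E) \ cell part c).ncard) {O : Set V} (hO : t ≤ O.ncard)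
    (hzO : ∀ w ∈ O, OutAdj G part z w ∧ part w ∈ J) :
    ExtendsToUnits G part J x y z Q E := by
  have hinj := (hr.injective h hQ.disj).injOn (s := Nᶜ)
  have hWcard := ncard_image_compl_union_add (N := N) (E := E) hinj fun k _ => hr.notMem k
  obtain ⟨L, hL⟩ := h.exists_fan_cells hz ht (W := f '' Nᶜ ∪ E) (by
    rintro _ (⟨k, hk, rfl⟩ | hw)
    · exact ⟨hr.target_mem k, hfz k hk⟩
    · exact hEJ hw) (by omega) hWt hO hzO
  exact hQ.extendsToUnits hz hL hN (fun k _ => hr.touches k) hinj fun k _ => hr.notMem k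

theorem ConnOn.pair {u v : V} (h : G.Adj u v) : ConnOn G {u, v} :=
  (ConnOn.singleton G v).insert_of_touches ⟨v, rfl, h⟩

end Finish

namespace IsComposed

variable {V : Type*} {p m : ℕ} {G : SimpleGraph V} {part : V → Fin p} {x y z : V}

/-- Links between two vertices of a part, with representatives of the links. -/
theorem exists_links_reps [Finite V] (h : IsComposed G part m) (hxy : x ≠ y)
    (hp : part y = part x) {k : ℕ} (hk : k ≤ m) (hk' : G.Adj x y → k + 1 ≤ m) (hk0 : 0 < k)
    {E : Set V} (hE : ∀ w ∈ E, ∀ g, part g = part x → OutAdj G part g w → g = x ∨ g = y) :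
    ∃ (Q : Fin k → Set V) (v f : Fin k → V), IsLinkFamily G part {part x}ᶜ x y Q ∧
      IsReps G part {part x}ᶜ (part x) Q E v f ∧
      ∀ g, part g = part x → g ∉ ({x, y} : Set V) → ∃ k, g ∈ Q k := by
  obtain ⟨Q, hd, hQ, hcov⟩ := h.exists_links_cell rfl hp hxy hk hk' hk0
  have hQx : ∀ l, x ∉ Q l := fun l hl => ((hQ l).2.1 hl).2 (Or.inl rfl)
  have hQy : ∀ l, y ∉ Q l := fun l hl => ((hQ l).2.1 hl).2 (Or.inr rfl)
  have hrep : ∀ l, ∃ v ∈ Q l, ∃ f, OutAdj G part v f := by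
    intro l
    obtain ⟨v, hv⟩ := (hQ l).1.1
    obtain ⟨f, -, hf, -⟩ := h.out v
    exact ⟨v, hv, f, hf⟩
  choose v hv f hf using hrep
  have hvp : ∀ l, part (v l) = part x := fun l => ((hQ l).2.1 (hv l)).1
  refine ⟨Q, v, f, ⟨by simp, by simp [hp], fun l => (hQ l).1, fun l => ?_, hQx, hQy, hd,
    fun l => (hQ l).2.2.1, fun l => (hQ l).2.2.2⟩, ⟨hv, hvp, hf, fun l hl => ?_, fun l hl => ?_⟩,
    fun g hg hgxy => hcov g ⟨hg, hgxy⟩⟩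
  · rw [Set.disjoint_left]
    exact fun u hu hu' => hu' ((hQ l).2.1 hu).1
  · exact (hf l).2 (hl.trans (hvp l).symm)
  · rcases hE _ hl _ (hvp l) (hf l) with h1 | h1
    · exact hQx l (h1 ▸ hv l)
    · exact hQy l (h1 ▸ hv l)

theorem eq_of_out (h : IsComposed G part m) {u v w : V} (hu : OutAdj G part u w)
    (hv : OutAdj G part v w) (huv : part u = part v) : u = v :=
  h.out_unique hv.symm hu.symm huv

theorem exists_out_part_ne (h : IsComposed G part m) (v : V) (c : Fin p) :
    ∃ w, OutAdj G part v w ∧ part w ≠ c := by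
  obtain ⟨w₁, w₂, h1, h2, h3, -⟩ := h.out v
  by_cases hc : part w₁ = c
  · exact ⟨w₂, h2, fun h => h3 (hc.trans h.symm)⟩
  · exact ⟨w₁, h1, hc⟩

theorem ncard_compl_compl_singleton_le (i : Fin p) : (({i}ᶜ : Set (Fin p))ᶜ).ncard ≤ 2 := by
  simp

theorem connectsSet_two_one_of_adj [Finite V] (h : IsComposed G part m) (hxy : x ≠ y)
    (hp : part y = part x) (hz : part z ≠ part x) (hxz : G.Adj x z) :
    ConnectsSet G {x, y, z} (m + 1) := by
  have hm := h.four_le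
  have hxz' : OutAdj G part x z := ⟨hxz, hz⟩
  have hzu : ∀ g, part g = part x → OutAdj G part g z → g = x := fun g hg hgz =>
    h.eq_of_out hgz hxz' hg
  obtain ⟨o, hzo, hox, -⟩ := h.exists_other_out hxz'.symm
  have hyz : ∀ w, OutAdj G part y w → w ≠ z := by
    rintro w hw rfl
    exact hxy (hzu y hp hw).symm
  by_cases hadj : G.Adj x y
  · obtain ⟨x', hx', hx'z, -⟩ := h.exists_other_out hxz'
    obtain ⟨y', hy', hy'x'⟩ := h.exists_out_part_ne y (part x')
    have hne : x' ≠ y' := fun h => hy'x' (by rw [h])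
    obtain ⟨Q, v, f, hQ, hr, hcov⟩ := h.exists_links_reps (k := m - 1) (E := {x', y'}) hxy hp
      (by omega) (fun _ => by omega) (by omega) (by
        rintro w (rfl | rfl) g hg hgw
        · exact Or.inl (h.eq_of_out hgw hx' hg)
        · exact Or.inr (h.eq_of_out hgw hy' (hg.trans hp.symm)))
    have := (hQ.extendsToUnits_of_reps h hz hr (N := ∅) (t := 1) (by
        rintro w (rfl | rfl)
        · exact ⟨hx'.2, fun h => hx'z (by rw [show w = z from h])⟩
        · exact ⟨hp ▸ hy'.2, hyz _ hy'⟩) (by simp) (fun k _ hk => hQ.left_off k (by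
          have h1 := hr.out k
          rw [hk] at h1
          exact hzu _ (hr.part_eq k) h1 ▸ hr.mem k)) (by omega) (by
          rw [Set.ncard_pair hne, Fintype.card_fin, Set.ncard_empty]; omega)
      (one_le_ncard_diff_cell (Or.inr (Or.inl rfl)) (Or.inr (Or.inr rfl)) hy'x'.symm)
      (O := {o}) (by simp) (by
        rintro w rfl
        exact ⟨hzo, hox⟩)).connectsSet_of_hub hQ.left_notMem hQ.mid_notMem (Or.inl rfl)
        (Or.inr rfl) hx'.1 hy'.1 (fun L hL => by
          have h1 := (ConnOn.pair hxz).insert_of_touches (x := y) ⟨x, Or.inl rfl, hadj.symm⟩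
          rw [Set.insert_comm] at h1
          simpa using h1)
    rw [Fintype.card_fin] at this
    convert this using 1
    omega
  · obtain ⟨y', hy', -⟩ := h.exists_out_part_ne y (part y)
    have hEx : ∀ g, part g = part x → OutAdj G part g y' → g = y := fun g hg hgw =>
      h.eq_of_out hgw hy' (hg.trans hp.symm)
    obtain ⟨Q, v, f, hQ, hr, hcov⟩ := h.exists_links_reps (k := m) (E := {y'}) hxy hp
      le_rfl (fun h => absurd h hadj) (by omega) (by
        rintro w rfl g hg hgw
        exact Or.inr (hEx g hg hgw))
    have : Nontrivial (Fin m) := Fin.nontrivial_iff_two_le.2 (by omega)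
    obtain ⟨v, f, hr, k, l, hkl⟩ := hr.exists_two_parts h (by simp)
      (ncard_compl_compl_singleton_le _) (F := {x, y}) (by rw [Set.ncard_pair hxy]) hcov
      (e := y') (fun w hw hwy => absurd hw hwy)
    have := (hQ.extendsToUnits_of_reps h hz hr (N := ∅) (t := 1) (by
        rintro w rfl
        exact ⟨hp ▸ hy'.2, hyz _ hy'⟩) (by simp) (fun k _ hk => hQ.left_off k (by
          have h1 := hr.out k
          rw [hk] at h1
          exact hzu _ (hr.part_eq k) h1 ▸ hr.mem k)) (by omega) (by
          rw [Set.ncard_singleton, Fintype.card_fin, Set.ncard_empty])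
      (one_le_ncard_diff_cell (Or.inl ⟨k, by simp, rfl⟩) (Or.inl ⟨l, by simp, rfl⟩) hkl)
      (O := {o}) (by simp) (by
        rintro w rfl
        exact ⟨hzo, hox⟩)).connectsSet ∅ (by simp) (by simp) (fun L hL => by
          have h1 := ((hL.conn y' rfl).insert_of_touches (x := z) (hL.touches y' rfl))
          have h2 := h1.insert_of_touches (x := y) ⟨y', Or.inr (hL.mem y' rfl), hy'.1⟩
          have h3 := h2.insert_of_touches (x := x) ⟨z, Or.inr (Or.inl rfl), hxz⟩
          convert h3 using 1
          ext v
          simp)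
    rwa [Fintype.card_fin] at this

theorem connectsSet_two_one [Finite V] (h : IsComposed G part m) (hxy : x ≠ y)
    (hp : part y = part x) (hz : part z ≠ part x) : ConnectsSet G {x, y, z} (m + 1) := by
  have hm := h.four_le
  by_cases hxz : G.Adj x z
  · exact h.connectsSet_two_one_of_adj hxy hp hz hxz
  by_cases hyz : G.Adj y z
  · rw [Set.insert_comm]
    exact h.connectsSet_two_one_of_adj hxy.symm hp.symm (hp ▸ hz) hyz
  have hxz' : ∀ w, OutAdj G part x w → w ≠ z := fun w hw hwz => hxz (hwz ▸ hw.1)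
  have hyz' : ∀ w, OutAdj G part y w → w ≠ z := fun w hw hwz => hyz (hwz ▸ hw.1)
  have hσ : ∀ u u', OutAdj G part z u → OutAdj G part z u' → part u ∉ ({part x}ᶜ : Set (Fin p)) →
      part u' ∉ ({part x}ᶜ : Set (Fin p)) → u = u' := by
    intro u u' hu hu' hux hux'
    simp only [Set.mem_compl_iff, Set.mem_singleton_iff, not_not] at hux hux'
    exact h.out_unique hu' hu (hux.trans hux'.symm)
  obtain ⟨x₁, x₂, hx₁, hx₂, hx₁₂, -⟩ := h.out x
  obtain ⟨y', hy', hy'x⟩ := h.exists_out_part_ne y (part x₁)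
  have hx₁y : x₁ ≠ y' := fun h => hy'x (by rw [h])
  have hEx : ∀ w, OutAdj G part x w → ∀ g, part g = part x → OutAdj G part g w → g = x :=
    fun w hw g hg hgw => h.eq_of_out hgw hw hg
  have hEy : ∀ g, part g = part x → OutAdj G part g y' → g = y := fun g hg hgw =>
    h.eq_of_out hgw hy' (hg.trans hp.symm)
  have hσQ : ∀ {k : ℕ} (Q : Fin k → Set V),
      (∀ g, part g = part x → g ∉ ({x, y} : Set V) → ∃ k, g ∈ Q k) →
      ∀ u, OutAdj G part z u → part u ∉ ({part x}ᶜ : Set (Fin p)) → ∃ k, u ∈ Q k := by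
    intro k Q hcov u hu hux
    simp only [Set.mem_compl_iff, Set.mem_singleton_iff, not_not] at hux
    refine hcov u hux ?_
    rintro (rfl | rfl)
    · exact hxz hu.1.symm
    · exact hyz hu.1.symm
  by_cases hadj : G.Adj x y
  · have hx₂y : x₂ ≠ y' := by
      rintro rfl
      exact hxy (hEy x rfl hx₂)
    have hx₁x₂ : x₁ ≠ x₂ := fun h => hx₁₂ (by rw [h])
    have hE : ∀ w ∈ ({x₁, y', x₂} : Set V), ∀ g, part g = part x → OutAdj G part g w →
        g = x ∨ g = y := by
      rintro w (rfl | rfl | rfl) g hg hgw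
      · exact Or.inl (hEx _ hx₁ g hg hgw)
      · exact Or.inr (hEy g hg hgw)
      · exact Or.inl (hEx _ hx₂ g hg hgw)
    obtain ⟨Q, v, f, hQ, hr, hcov⟩ := h.exists_links_reps (k := m - 1) (E := {x₁, y', x₂}) hxy hp
      (by omega) (fun _ => by omega) (by omega) hE
    have : Nontrivial (Fin (m - 1)) := Fin.nontrivial_iff_two_le.2 (by omega)
    have hE3 : ({x₁, y', x₂} : Set V).ncard = 3 :=
      Set.ncard_eq_three.2 ⟨x₁, y', x₂, hx₁y, hx₁x₂, hx₂y.symm, rfl⟩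
    have := (hQ.extendsToUnits_of_subsingleton h hz (by
        rw [Fintype.card_fin, hE3]; omega) (by simp)
        (ncard_compl_compl_singleton_le _) (F := {x, y}) (by rw [Set.ncard_pair hxy]) hcov
        (e := x) (fun w hw _ g hg hgw => hE w hw g hg hgw) hr (by
          rintro w (rfl | rfl | rfl)
          · exact ⟨hx₁.2, hxz' _ hx₁⟩
          · exact ⟨hp ▸ hy'.2, hyz' _ hy'⟩
          · exact ⟨hx₂.2, hxz' _ hx₂⟩) (Or.inl rfl) (Or.inr (Or.inl rfl)) hy'x.symm hσ
          (hσQ Q hcov)).connectsSet_of_hub hQ.left_notMem hQ.mid_notMem (Or.inl rfl)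
          (Or.inr (Or.inl rfl)) hx₁.1 hy'.1 (fun L hL => by
            have hmem : x₂ ∈ ({x₁, y', x₂} : Set V) := by simp
            have h1 := (hL.conn x₂ hmem).insert_of_touches (x := z) (hL.touches x₂ hmem)
            have h2 := h1.insert_of_touches (x := x) ⟨x₂, Or.inr (hL.mem x₂ hmem), hx₂.1⟩
            have h3 := h2.insert_of_touches (x := y) ⟨x, Or.inl rfl, hadj.symm⟩
            have h4 : ({x₁, y', x₂} : Set V) \ {x₁, y'} = {x₂} := by
              ext v
              simp only [Set.mem_sdiff, Set.mem_insert_iff, Set.mem_singleton_iff]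
              constructor
              · tauto
              · rintro rfl
                exact ⟨by simp, by simp [hx₁x₂.symm, hx₂y]⟩
            rw [h4]
            convert h3 using 1
            ext v
            simp
            tauto)
    rw [Fintype.card_fin] at this
    convert this using 1
    omega
  · have hE : ∀ w ∈ ({x₁, y'} : Set V), ∀ g, part g = part x → OutAdj G part g w →
        g = x ∨ g = y := by
      rintro w (rfl | rfl) g hg hgw
      · exact Or.inl (hEx _ hx₁ g hg hgw)
      · exact Or.inr (hEy g hg hgw)
    obtain ⟨Q, v, f, hQ, hr, hcov⟩ := h.exists_links_reps (k := m) (E := {x₁, y'}) hxy hp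
      le_rfl (fun h => absurd h hadj) (by omega) hE
    have : Nontrivial (Fin m) := Fin.nontrivial_iff_two_le.2 (by omega)
    have := (hQ.extendsToUnits_of_subsingleton h hz (by
        rw [Fintype.card_fin, Set.ncard_pair hx₁y]) (by simp)
        (ncard_compl_compl_singleton_le _) (F := {x, y}) (by rw [Set.ncard_pair hxy]) hcov
        (e := x) (fun w hw _ g hg hgw => hE w hw g hg hgw) hr (by
          rintro w (rfl | rfl)
          · exact ⟨hx₁.2, hxz' _ hx₁⟩
          · exact ⟨hp ▸ hy'.2, hyz' _ hy'⟩) (Or.inl rfl) (Or.inr rfl) hy'x.symm hσ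
          (hσQ Q hcov)).connectsSet_of_pair hx₁.1 hy'.1
    rwa [Fintype.card_fin] at this

end IsComposed

section Core

variable {V κ : Type*} {p m : ℕ} {G : SimpleGraph V} {part : V → Fin p} {x y z : V}
  {Q : κ → Set V}

theorem ncard_compl_compl_pair_le (a b : Fin p) : (({a, b}ᶜ : Set (Fin p))ᶜ).ncard ≤ 2 := by
  rw [compl_compl]
  exact (Set.ncard_insert_le a {b}).trans (by simp)

/-- Links between `x` and `y` covering, together with a connected core `D` joining `x` and `y`,
the parts of `x` and `y`, extend to internally disjoint trees connecting `x`, `y` and `z`. -/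
theorem IsLinkFamily.connectsSet_of_core [Finite V] [Fintype κ] (h : IsComposed G part m)
    (hQ : IsLinkFamily G part {part x, part y}ᶜ x y Q) (hcard : Fintype.card κ = m)
    (hz : part z ∈ ({part x, part y}ᶜ : Set (Fin p))) {x₃ : V} (hx₃ : OutAdj G part x x₃)
    (hx₃J : part x₃ ∈ ({part x, part y}ᶜ : Set (Fin p))) {v f : κ → V}
    (hr : IsReps G part {part x, part y}ᶜ (part x) Q {x₃} v f) {D : Set V}
    (hD : Disjoint D (cells part {part x, part y}ᶜ)) (hDQ : ∀ k, Disjoint D (Q k))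
    (hDc : ConnOn G (insert x (insert y D)))
    (hcov : ∀ g, part g = part x → g ≠ x → ∃ k, g ∈ Q k)
    (hcov' : ∀ g, part g = part y → g ≠ y → g ∉ D → ∃ k, g ∈ Q k) :
    ConnectsSet G {x, y, z} (m + 1) := by
  have hm := h.four_le
  have hi : part x ∉ ({part x, part y}ᶜ : Set (Fin p)) := by simp
  have hvx : ∀ k, v k ≠ x := fun k hk => hQ.left_off k (hk ▸ hr.mem k)
  have hvz : ∀ k, f k = z → OutAdj G part z (v k) := fun k hk => hk ▸ (hr.out k).symm
  have hleg : x₃ ≠ z → ∀ L, IsFan G z (cells part {part x, part y}ᶜ \ {z}) {x₃} L →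
      ConnOn G (D ∪ (⋃ w ∈ ({x₃} : Set V), L w) ∪ {x, y, z}) := by
    intro _ L hL
    have h1 := (hL.conn x₃ rfl).insert_of_touches (x := z) (hL.touches x₃ rfl)
    have h2 := hDc.union h1
      ⟨x, Or.inl rfl, x₃, Or.inr (hL.mem x₃ rfl), Or.inr hx₃.1⟩
    convert h2 using 1
    ext u
    simp
    tauto
  by_cases hσ : ∃ u, OutAdj G part z u ∧ part u ∉ ({part x, part y}ᶜ : Set (Fin p))
  · obtain ⟨n, hzn, hnJ, hn⟩ : ∃ n, OutAdj G part z n ∧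
        part n ∉ ({part x, part y}ᶜ : Set (Fin p)) ∧
        ∀ u, OutAdj G part z u → part u = part x → u = n := by
      by_cases hσ' : ∃ u, OutAdj G part z u ∧ part u = part x
      · obtain ⟨u, hu, hux⟩ := hσ'
        exact ⟨u, hu, by simp [hux], fun w hw hwx => h.out_unique hu hw (hwx.trans hux.symm)⟩
      · push Not at hσ'
        obtain ⟨u, hu, huJ⟩ := hσ
        exact ⟨u, hu, huJ, fun w hw hwx => absurd hwx (hσ' w hw)⟩
    by_cases hnQ : ∃ k, n ∈ Q k
    · obtain ⟨k₀, hk₀⟩ := hnQ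
      have hx₃z : x₃ ≠ z := by
        rintro rfl
        exact hQ.left_off k₀ (hn x hx₃.symm rfl ▸ hk₀)
      have := (hQ.extendsToUnits_of_reps h hz hr (N := {k₀}) (t := 0) (O := ∅) (by
          rintro w rfl
          exact ⟨hx₃J, hx₃z⟩) (by
          rintro k rfl
          exact ⟨n, hk₀, hzn.1⟩) (by
          intro k hk hkz
          have h1 := hn _ (hvz k hkz) (hr.part_eq k)
          exact Set.disjoint_left.1 (hQ.disj hk) (hr.mem k) (h1 ▸ hk₀)) (by omega) (by
          simp [hcard]) (by simp) (by simp) (by simp)).connectsSet D hD hDQ (hleg hx₃z)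
      rwa [hcard] at this
    · have hnD : n ∈ insert x (insert y D) := by
        by_contra hcon
        simp only [Set.mem_insert_iff, not_or] at hcon
        simp only [Set.mem_compl_iff, Set.mem_insert_iff, Set.mem_singleton_iff, not_not] at hnJ
        rcases hnJ with h1 | h1
        · exact hnQ (hcov n h1 hcon.1)
        · exact hnQ (hcov' n h1 hcon.2.1 hcon.2.2)
      have hr' : IsReps G part {part x, part y}ᶜ (part x) Q ∅ v f :=
        ⟨hr.mem, hr.part_eq, hr.out, hr.target_mem, by simp⟩
      have := (hQ.extendsToUnits_of_reps h hz hr' (N := ∅) (t := 0) (O := ∅) (by simp) (by simp)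
        (fun k _ hkz => hnQ ⟨k, hn _ (hvz k hkz) (hr.part_eq k) ▸ hr.mem k⟩) (by omega)
        (by simp [hcard]) (by simp) (by simp) (by simp)).connectsSet D hD hDQ (fun L _ => by
          have h2 := hDc.insert_of_touches (x := z) ⟨n, hnD, hzn.1⟩
          convert h2 using 1
          ext u
          simp
          tauto)
      rwa [hcard] at this
  · push Not at hσ
    have hx₃z : x₃ ≠ z := by
      rintro rfl
      exact hi (hσ x hx₃.symm)
    have : Nontrivial κ := Fintype.one_lt_card_iff_nontrivial.1 (by omega)
    obtain ⟨v, f, hr, k, l, hkl⟩ := hr.exists_two_parts h hi (ncard_compl_compl_pair_le _ _)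
      (F := {x}) (by simp) (fun g hg hgx => hcov g hg hgx) (e := x₃)
      (fun w hw hwx => absurd hw hwx)
    obtain ⟨o, -, hzo, -⟩ := h.out z
    have := (hQ.extendsToUnits_of_reps h hz hr (N := ∅) (t := 1) (by
        rintro w rfl
        exact ⟨hx₃J, hx₃z⟩) (by simp) (fun k _ hk => by
        have h1 := hσ (v k) (hk ▸ (hr.out k).symm)
        rw [hr.part_eq] at h1
        exact hi h1) (by omega) (by
        rw [Set.ncard_singleton, hcard, Set.ncard_empty])
      (one_le_ncard_diff_cell (Or.inl ⟨k, by simp, rfl⟩) (Or.inl ⟨l, by simp, rfl⟩) hkl)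
      (O := {o}) (by simp) (by
        rintro w rfl
        exact ⟨hzo, hσ _ hzo⟩)).connectsSet D hD hDQ (hleg hx₃z)
    rwa [hcard] at this

end Core

namespace IsComposed

variable {V : Type*} {p m : ℕ} {G : SimpleGraph V} {part : V → Fin p} {x y z : V}

theorem exists_exits [Finite V] (h : IsComposed G part m) {i j : Fin p} (hij : i ≠ j) {X : Set V}
    {n : ℕ} (hn : n + X.ncard ≤ m + 2) :
    ∃ a b : Fin n → V, Function.Injective a ∧ ∀ k, OutAdj G part (a k) (b k) ∧
      part (a k) = i ∧ part (b k) = j ∧ a k ∉ X ∧ b k ∉ X := by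
  have h1 := h.le_cross_avoid hij X
  set F := {e : V × V | G.Adj e.1 e.2 ∧ part e.1 = i ∧ part e.2 = j ∧ e.1 ∉ X ∧ e.2 ∉ X} with hF
  obtain ⟨g, hg⟩ : ∃ g : Fin n → V × V, Function.Injective g ∧ ∀ k, g k ∈ F := by
    have : Fintype F := Fintype.ofFinite F
    have hle : Fintype.card (Fin n) ≤ Fintype.card F := by
      rw [Fintype.card_fin, ← Nat.card_eq_fintype_card, Nat.card_coe_set_eq]
      omega
    obtain ⟨g⟩ := Function.Embedding.nonempty_of_card_le hle
    exact ⟨fun k => g k, fun k l hkl => g.injective (Subtype.ext hkl), fun k => (g k).2⟩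
  have hout : ∀ k, OutAdj G part (g k).1 (g k).2 := fun k =>
    ⟨(hg.2 k).1, by rw [(hg.2 k).2.1, (hg.2 k).2.2.1]; exact hij.symm⟩
  refine ⟨fun k => (g k).1, fun k => (g k).2, fun k l hkl => hg.1 (Prod.ext hkl ?_),
    fun k => ⟨hout k, (hg.2 k).2⟩⟩
  have hkl : (g k).1 = (g l).1 := hkl
  exact h.out_unique (hkl ▸ hout l) (hout k) ((hg.2 k).2.2.1.trans (hg.2 l).2.2.1.symm)

/-- The cross edges between two parts joined to fans from `x` and `y` form links. -/
theorem isLinkFamily_union {κ : Type*} (hxy : part x ≠ part y) {C C' : κ → Set V} {a b : κ → V}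
    (hd : Pairwise fun k l => Disjoint (C k) (C l))
    (hC : ∀ k, ConnOn G (C k) ∧ C k ⊆ cell part (part x) \ {x} ∧ a k ∈ C k ∧ Touches G x (C k))
    (hd' : Pairwise fun k l => Disjoint (C' k) (C' l))
    (hC' : ∀ k, (C' k = ∅ ∧ G.Adj y (a k)) ∨ ConnOn G (C' k) ∧
      C' k ⊆ cell part (part y) \ {y} ∧ b k ∈ C' k ∧ Touches G y (C' k) ∧ G.Adj (a k) (b k)) :
    IsLinkFamily G part {part x, part y}ᶜ x y fun k => C k ∪ C' k := by
  have hsub' : ∀ k, C' k ⊆ cell part (part y) \ {y} := by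
    intro k
    rcases hC' k with ⟨h1, -⟩ | h1
    · simp [h1]
    · exact h1.2.1
  have hCC : ∀ k l, Disjoint (C k) (C' l) := by
    intro k l
    rw [Set.disjoint_left]
    exact fun u hu hu' => hxy (((hC k).2.1 hu).1.symm.trans (hsub' l hu').1)
  refine ⟨by simp, by simp, fun k => ?_, fun k => ?_, fun k => ?_, fun k => ?_, fun k l hkl => ?_,
    fun k => (hC k).2.2.2.mono Set.subset_union_left, fun k => ?_⟩
  · rcases hC' k with ⟨h1, -⟩ | h1
    · simpa [h1] using (hC k).1
    · exact (hC k).1.union h1.1 ⟨a k, (hC k).2.2.1, b k, h1.2.2.1, Or.inr h1.2.2.2.2⟩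
  · rw [Set.disjoint_left]
    rintro u (hu | hu) hu'
    · exact hu' (Or.inl ((hC k).2.1 hu).1)
    · exact hu' (Or.inr (hsub' k hu).1)
  · rintro (hu | hu)
    · exact ((hC k).2.1 hu).2 rfl
    · exact hxy (hsub' k hu).1
  · rintro (hu | hu)
    · exact hxy ((hC k).2.1 hu).1.symm
    · exact (hsub' k hu).2 rfl
  · exact Set.disjoint_union_left.2 ⟨Set.disjoint_union_right.2 ⟨hd hkl, hCC k l⟩,
      Set.disjoint_union_right.2 ⟨(hCC l k).symm, hd' hkl⟩⟩
  · rcases hC' k with ⟨-, h1⟩ | h1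
    · exact ⟨a k, Or.inl (hC k).2.2.1, h1⟩
    · exact h1.2.2.2.1.mono Set.subset_union_right

theorem isReps_union (h : IsComposed G part m) {κ : Type*} {C C' : κ → Set V} {a b : κ → V}
    {E : Set V}
    (hC : ∀ k, C k ⊆ cell part (part x) \ {x} ∧ a k ∈ C k)
    (hab : ∀ k, OutAdj G part (a k) (b k) ∧ part (b k) = part y)
    (hE : ∀ w ∈ E, ∀ k, ¬ OutAdj G part (a k) w) :
    ∃ f : κ → V, IsReps G part {part x, part y}ᶜ (part x) (fun k => C k ∪ C' k) E a f := by
  choose f hf hfne _ using fun k => h.exists_other_out (hab k).1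
  refine ⟨f, fun k => Or.inl (hC k).2, fun k => ((hC k).1 (hC k).2).1, hf, fun k => ?_,
    fun k hk => hE _ hk k (hf k)⟩
  rintro (h1 | h1)
  · exact (hf k).2 (h1.trans ((hC k).1 (hC k).2).1.symm)
  · exact hfne k (h1.trans (hab k).2.symm)

/-- `v` has an outside neighbour in the part of `w`. -/
def _root_.OutTo (G : SimpleGraph V) (part : V → Fin p) (v w : V) : Prop :=
  ∃ u, OutAdj G part v u ∧ part u = part w

theorem connectsSet_of_outTo [Finite V] (h : IsComposed G part m) (hxy : part x ≠ part y)
    (hxz : part x ≠ part z) (hyz : part y ≠ part z) (hx : OutTo G part x y)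
    (hy : OutTo G part y x) : ConnectsSet G {x, y, z} (m + 1) := by
  have hm := h.four_le
  have hz : part z ∈ ({part x, part y}ᶜ : Set (Fin p)) := by simp [hxz.symm, hyz.symm]
  obtain ⟨x₂, hx₂, hx₂y⟩ := hx
  obtain ⟨y₁, hy₁, hy₁x⟩ := hy
  obtain ⟨x₃, hx₃, hx₃₂, -⟩ := h.exists_other_out hx₂
  have hx₃J : part x₃ ∈ ({part x, part y}ᶜ : Set (Fin p)) := by
    simp [hx₃.2, ← hx₂y, hx₃₂]
  have hE : ∀ w ∈ ({x₃} : Set V), ∀ a, part a = part x → a ≠ x → ¬ OutAdj G part a w := by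
    rintro w rfl a ha hax haw
    exact hax (h.eq_of_out haw hx₃ ha)
  by_cases hadj : x₂ = y
  · subst hadj
    obtain ⟨a, b, hinj, hab⟩ := h.exists_exits hxy (X := {x, x₂}) (n := m) (by
      rw [Set.ncard_pair hx₂.1.ne])
    have hax : ∀ k, a k ≠ x := fun k hk => (hab k).2.2.2.1 (Or.inl hk)
    have hby : ∀ k, b k ≠ x₂ := fun k hk => (hab k).2.2.2.2 (Or.inr hk)
    have hinj' : Function.Injective b := fun k l hkl => hinj (h.eq_of_out (hab k).1
      (hkl ▸ (hab l).1) ((hab k).2.1.trans (hab l).2.1.symm))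
    have : Nonempty (Fin m) := ⟨⟨0, by omega⟩⟩
    obtain ⟨C, hd, hC, hcov⟩ := h.exists_fan_cell rfl a hinj (fun k => (hab k).2.1) hax (by simp)
    obtain ⟨C', hd', hC', hcov'⟩ := h.exists_fan_cell rfl b hinj' (fun k => (hab k).2.2.1) hby
      (by simp)
    have hQ := isLinkFamily_union hxy (b := b) hd hC hd' fun k => Or.inr
      ⟨(hC' k).1, (hC' k).2.1, (hC' k).2.2.1, (hC' k).2.2.2, (hab k).1.1⟩
    obtain ⟨f, hr⟩ := h.isReps_union (C' := C') (E := {x₃})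
      (fun k => ⟨(hC k).2.1, (hC k).2.2.1⟩) (fun k => ⟨(hab k).1, (hab k).2.2.1⟩)
      (fun w hw k => hE w hw _ (hab k).2.1 (hax k))
    refine hQ.connectsSet_of_core h (by simp) hz hx₃ hx₃J hr (D := ∅) (by simp) (by simp) ?_ ?_ ?_
    · simpa using ConnOn.pair hx₂.1
    · intro g hg hgx
      obtain ⟨k, hk⟩ := hcov g ⟨hg, hgx⟩
      exact ⟨k, Or.inl hk⟩
    · intro g hg hgy _
      obtain ⟨k, hk⟩ := hcov' g ⟨hg, hgy⟩
      exact ⟨k, Or.inr hk⟩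
  · have hxy₁ : y₁ ≠ x := by
      rintro rfl
      exact hadj (h.out_unique hx₂ hy₁.symm hx₂y.symm).symm
    obtain ⟨a, b, hinj, hab⟩ := h.exists_exits hxy (X := {x, y}) (n := m - 1) (by
      rw [Set.ncard_pair fun h => hxy (by rw [h])]; omega)
    have hax : ∀ k, a k ≠ x := fun k hk => (hab k).2.2.2.1 (Or.inl hk)
    have hby : ∀ k, b k ≠ y := fun k hk => (hab k).2.2.2.2 (Or.inr hk)
    have hay₁ : ∀ k, a k ≠ y₁ := fun k hk => hby k
      (h.out_unique (hk ▸ hy₁.symm) (hab k).1 (hab k).2.2.1)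
    have hbx₂ : ∀ k, b k ≠ x₂ := fun k hk => hax k
      (h.eq_of_out (hk ▸ (hab k).1) hx₂ (hab k).2.1)
    have hinj' : Function.Injective b := fun k l hkl => hinj (h.eq_of_out (hab k).1
      (hkl ▸ (hab l).1) ((hab k).2.1.trans (hab l).2.1.symm))
    have hcard : Fintype.card (Option (Fin (m - 1))) = m := by
      rw [Fintype.card_option, Fintype.card_fin]
      omega
    obtain ⟨C, hd, hC, hcov⟩ := h.exists_fan_cell rfl (fun k : Option (Fin (m - 1)) => k.elim y₁ a)
      (by
        rintro (_ | k) (_ | l) hkl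
        · rfl
        · exact absurd hkl.symm (hay₁ l)
        · exact absurd hkl (hay₁ k)
        · exact congrArg some (hinj hkl))
      (by rintro (_ | k); exacts [hy₁x, (hab k).2.1])
      (by rintro (_ | k); exacts [hxy₁, hax k]) hcard.le
    obtain ⟨C', hd', hC', hcov'⟩ := h.exists_fan_cell rfl
      (fun k : Option (Fin (m - 1)) => k.elim x₂ b)
      (by
        rintro (_ | k) (_ | l) hkl
        · rfl
        · exact absurd hkl.symm (hbx₂ l)
        · exact absurd hkl (hbx₂ k)
        · exact congrArg some (hinj' hkl))
      (by rintro (_ | k); exacts [hx₂y, (hab k).2.2.1])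
      (by rintro (_ | k); exacts [hadj, hby k]) hcard.le
    let R : Option (Fin (m - 1)) → Set V := fun k => k.elim ∅ fun k => C' (some k)
    have hRC : ∀ k, R k ⊆ C' k := by
      rintro (_ | k)
      · exact Set.empty_subset _
      · exact subset_rfl
    have hQ := isLinkFamily_union hxy (C' := R) (b := fun k => k.elim x₂ b) hd hC
      (fun k l hkl => (hd' hkl).mono (hRC k) (hRC l)) (by
        rintro (_ | k)
        · exact Or.inl ⟨rfl, hy₁.1⟩
        · exact Or.inr ⟨(hC' _).1, (hC' _).2.1, (hC' (some k)).2.2.1, (hC' _).2.2.2,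
            (hab k).1.1⟩)
    obtain ⟨f, hr⟩ := h.isReps_union (y := y) (C' := R) (E := {x₃}) (b := fun k => k.elim y b)
      (fun k => ⟨(hC k).2.1, (hC k).2.2.1⟩) (by
        rintro (_ | k)
        · exact ⟨hy₁.symm, rfl⟩
        · exact ⟨(hab k).1, (hab k).2.2.1⟩)
      (fun w hw k => hE w hw _ ((hC k).2.1 (hC k).2.2.1).1 fun h =>
        ((hC k).2.1 (hC k).2.2.1).2 h)
    refine hQ.connectsSet_of_core h hcard hz hx₃ hx₃J hr (D := C' none) ?_ ?_ ?_ ?_ ?_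
    · rw [Set.disjoint_left]
      exact fun u hu hu' => hu' (Or.inr ((hC' none).2.1 hu).1)
    · rintro k
      refine Set.disjoint_union_right.2 ⟨?_, ?_⟩
      · rw [Set.disjoint_left]
        exact fun u hu hu' => hxy (((hC k).2.1 hu').1.symm.trans ((hC' none).2.1 hu).1)
      · rcases k with _ | k
        · exact disjoint_bot_right
        · exact hd' (by simp)
    · exact ((hC' none).1.insert_of_touches (hC' none).2.2.2).insert_of_touches
        ⟨x₂, Or.inr (hC' none).2.2.1, hx₂.1⟩
    · intro g hg hgx
      obtain ⟨k, hk⟩ := hcov g ⟨hg, hgx⟩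
      exact ⟨k, Or.inl hk⟩
    · intro g hg hgy hgD
      obtain ⟨_ | k, hk⟩ := hcov' g ⟨hg, hgy⟩
      · exact absurd hk hgD
      · exact ⟨some k, Or.inr hk⟩

theorem _root_.OutAdj.outTo {v w : V} (h : OutAdj G part v w) : OutTo G part v w := ⟨w, h, rfl⟩

theorem connectsSet_of_not_outTo [Finite V] (h : IsComposed G part m) (hxy : part x ≠ part y)
    (hxz : part x ≠ part z) (hyz : part y ≠ part z) (hO : ¬ OutTo G part x y)
    (hzO : ¬ (OutTo G part z x ∧ OutTo G part z y))
    (hmx : ¬ (OutTo G part x z ∧ OutTo G part z x))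
    (hmy : ¬ (OutTo G part y z ∧ OutTo G part z y)) : ConnectsSet G {x, y, z} (m + 1) := by
  have hm := h.four_le
  have hz : part z ∈ ({part x, part y}ᶜ : Set (Fin p)) := by simp [hxz.symm, hyz.symm]
  have hxadj : ¬ G.Adj x z := fun hadj => hmx
    ⟨OutAdj.outTo ⟨hadj, hxz.symm⟩, OutAdj.outTo ⟨hadj.symm, hxz⟩⟩
  have hyadj : ¬ G.Adj y z := fun hadj => hmy
    ⟨OutAdj.outTo ⟨hadj, hyz.symm⟩, OutAdj.outTo ⟨hadj.symm, hyz⟩⟩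
  obtain ⟨y₁, hy₁, hy₁x⟩ := h.exists_out_part_ne y (part x)
  obtain ⟨x₁, hx₁, hx₁y₁⟩ := h.exists_out_part_ne x (part y₁)
  have hx₁y : part x₁ ≠ part y := fun hp => hO ⟨x₁, hx₁, hp⟩
  obtain ⟨u, hu⟩ : ∃ u, ∀ g, part g = part x → OutAdj G part g y₁ → g = u := by
    by_cases hex : ∃ u, part u = part x ∧ OutAdj G part u y₁
    · obtain ⟨u, hux, hu⟩ := hex
      exact ⟨u, fun g hg hgy => h.eq_of_out hgy hu (hg.trans hux.symm)⟩
    · push Not at hex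
      exact ⟨x, fun g hg hgy => absurd hgy (hex g hg)⟩
  obtain ⟨a, b, hinj, hab⟩ := h.exists_exits hxy (X := {y, u}) (n := m) (by
    have := Set.ncard_insert_le y {u}
    rw [Set.ncard_singleton] at this
    omega)
  have hax : ∀ k, a k ≠ x := fun k hk => hO ⟨b k, hk ▸ (hab k).1, (hab k).2.2.1⟩
  have hby : ∀ k, b k ≠ y := fun k hk => (hab k).2.2.2.2 (Or.inl hk)
  have hinj' : Function.Injective b := fun k l hkl => hinj (h.eq_of_out (hab k).1
    (hkl ▸ (hab l).1) ((hab k).2.1.trans (hab l).2.1.symm))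
  have : Nontrivial (Fin m) := Fin.nontrivial_iff_two_le.2 (by omega)
  obtain ⟨C, hd, hC, hcov⟩ := h.exists_fan_cell rfl a hinj (fun k => (hab k).2.1) hax (by simp)
  obtain ⟨C', hd', hC', hcov'⟩ := h.exists_fan_cell rfl b hinj' (fun k => (hab k).2.2.1) hby
    (by simp)
  have hQ := isLinkFamily_union hxy (b := b) hd hC hd' fun k => Or.inr
    ⟨(hC' k).1, (hC' k).2.1, (hC' k).2.2.1, (hC' k).2.2.2, (hab k).1.1⟩
  have hE : ∀ w ∈ ({x₁, y₁} : Set V), w ≠ y₁ → ∀ g, part g = part x → OutAdj G part g w →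
      g ∈ ({x} : Set V) := by
    rintro w (rfl | rfl) hw g hg hgw
    · exact h.eq_of_out hgw hx₁ hg
    · exact absurd rfl hw
  obtain ⟨f, hr⟩ := h.isReps_union (C' := C') (E := {x₁, y₁})
    (fun k => ⟨(hC k).2.1, (hC k).2.2.1⟩) (fun k => ⟨(hab k).1, (hab k).2.2.1⟩)
    (fun w hw k hk => by
      by_cases hwy : w = y₁
      · exact (hab k).2.2.2.1 (Or.inr (hu _ (hab k).2.1 (hwy ▸ hk)))
      · exact hax k (hE w hw hwy _ (hab k).2.1 hk))
  have hx₁J : part x₁ ∈ ({part x, part y}ᶜ : Set (Fin p)) := by simp [hx₁.2, hx₁y]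
  have hy₁J : part y₁ ∈ ({part x, part y}ᶜ : Set (Fin p)) := by simp [hy₁.2, hy₁x]
  have hJ : ∀ w : V, part w ∉ ({part x, part y}ᶜ : Set (Fin p)) →
      part w = part x ∨ part w = part y := by
    intro w hw
    simpa [or_iff_not_imp_left] using hw
  have := (hQ.extendsToUnits_of_subsingleton h hz (by
      rw [Fintype.card_fin, Set.ncard_pair fun h => hx₁y₁ (by rw [h])]) (by simp)
      (ncard_compl_compl_pair_le _ _) (F := {x}) (by simp) (fun g hg hgx => by
        obtain ⟨k, hk⟩ := hcov g ⟨hg, hgx⟩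
        exact ⟨k, Or.inl hk⟩) hE hr (by
        rintro w (rfl | rfl)
        · exact ⟨hx₁J, fun hw => hxadj ((show w = z from hw) ▸ hx₁.1)⟩
        · exact ⟨hy₁J, fun hw => hyadj ((show w = z from hw) ▸ hy₁.1)⟩)
      (Or.inl rfl) (Or.inr rfl) hx₁y₁ (by
        intro s t hs ht hsJ htJ
        rcases hJ s hsJ with h1 | h1 <;> rcases hJ t htJ with h2 | h2
        · exact h.out_unique ht hs (h1.trans h2.symm)
        · exact absurd ⟨⟨s, hs, h1⟩, ⟨t, ht, h2⟩⟩ hzO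
        · exact absurd ⟨⟨t, ht, h2⟩, ⟨s, hs, h1⟩⟩ hzO
        · exact h.out_unique ht hs (h1.trans h2.symm)) (by
        intro s hs hsJ
        rcases hJ s hsJ with h1 | h1
        · obtain ⟨k, hk⟩ := hcov s ⟨h1, fun hsx => hxadj ((show s = x from hsx) ▸ hs.1.symm)⟩
          exact ⟨k, Or.inl hk⟩
        · obtain ⟨k, hk⟩ := hcov' s ⟨h1, fun hsy => hyadj ((show s = y from hsy) ▸ hs.1.symm)⟩
          exact ⟨k, Or.inr hk⟩)).connectsSet_of_pair hx₁.1 hy₁.1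
  rwa [Fintype.card_fin] at this

theorem connectsSet_three_parts [Finite V] (h : IsComposed G part m) (hxy : part x ≠ part y)
    (hxz : part x ≠ part z) (hyz : part y ≠ part z) : ConnectsSet G {x, y, z} (m + 1) := by
  have e1 : ({x, z, y} : Set V) = {x, y, z} := by rw [Set.pair_comm]
  have e2 : ({y, z, x} : Set V) = {x, y, z} := by
    ext v
    simp only [Set.mem_insert_iff, Set.mem_singleton_iff]
    tauto
  have e3 : ({y, x, z} : Set V) = {x, y, z} := Set.insert_comm _ _ _
  by_cases m1 : OutTo G part x y ∧ OutTo G part y x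
  · exact h.connectsSet_of_outTo hxy hxz hyz m1.1 m1.2
  by_cases m2 : OutTo G part x z ∧ OutTo G part z x
  · exact e1 ▸ h.connectsSet_of_outTo hxz hxy hyz.symm m2.1 m2.2
  by_cases m3 : OutTo G part y z ∧ OutTo G part z y
  · exact e2 ▸ h.connectsSet_of_outTo hyz hxy.symm hxz.symm m3.1 m3.2
  by_cases hz : OutTo G part z x ∧ OutTo G part z y
  · rw [← e2]
    exact h.connectsSet_of_not_outTo hyz hxy.symm hxz.symm (by tauto) (by tauto) (by tauto)
      (by tauto)
  · by_cases hO : OutTo G part x y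
    · rw [← e3]
      exact h.connectsSet_of_not_outTo hxy.symm hyz hxz (by tauto) (by tauto) (by tauto)
        (by tauto)
    · exact h.connectsSet_of_not_outTo hxy hxz hyz hO hz m2 m3

end IsComposed

/-- Two disjoint connected sets outside the part `i`, each touching `x`, `y` and `z`. -/
structure IsHubPair {V : Type*} {p : ℕ} (G : SimpleGraph V) (part : V → Fin p) (i : Fin p)
    (x y z : V) (F : Bool → Set V) : Prop where
  conn : ∀ b, ConnOn G (F b)
  off : ∀ b, Disjoint (F b) (cell part i)
  disj : Disjoint (F true) (F false)
  left : ∀ b, Touches G x (F b)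
  mid : ∀ b, Touches G y (F b)
  right : ∀ b, Touches G z (F b)

/-- Three edges on a set of points either admit a proper `2`-colouring or form a triangle. -/
theorem exists_orientation {α : Type*} (a b c : Bool → α) (ha : a true ≠ a false)
    (hb : b true ≠ b false) (hc : c true ≠ c false) :
    (∃ s t u, ∀ v ∈ ({a s, b t, c u} : Set α), v ∉ ({a !s, b !t, c !u} : Set α)) ∨
    ∃ s t u, a s = c !u ∧ b t = a !s ∧ c u = b !t := by
  by_contra hcon
  simp only [Bool.exists_bool, Set.mem_insert_iff, Set.mem_singleton_iff, forall_eq_or_imp,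
    forall_eq, Bool.not_true, Bool.not_false] at hcon
  by_cases h1 : a true = b true <;> by_cases h2 : a true = b false <;>
    by_cases h3 : a false = b true <;> by_cases h4 : a false = b false <;>
    by_cases h5 : a true = c true <;> by_cases h6 : a true = c false <;>
    by_cases h7 : a false = c true <;> by_cases h8 : a false = c false <;>
    grind (splits := 60)

namespace IsComposed

variable {V : Type*} {p m : ℕ} {G : SimpleGraph V} {part : V → Fin p} {x y z : V}

theorem exists_disjoint_exits [Finite V] (h : IsComposed G part m) {s t : V} (hst : s ≠ t)
    (hp : part t = part s) {d e : Fin p} (hd : d ≠ part s) (he : e ≠ part s) :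
    ∃ (N N' : Set V) (c c' : Fin p), Disjoint N N' ∧ ConnOn G N ∧ ConnOn G N' ∧
      N ⊆ cell part (part s) ∧ N' ⊆ cell part (part s) ∧ s ∈ N ∧ t ∈ N' ∧
      (c = d ∧ c' = e ∨ c = e ∧ c' = d) ∧ (∃ v ∈ N, ∃ w, G.Adj v w ∧ part w = c) ∧
      ∃ v ∈ N', ∃ w, G.Adj v w ∧ part w = c' := by
  have hm := h.four_le
  obtain ⟨u, w, huw, hu, hw, -, -⟩ := h.exists_cross_avoid hd.symm (X := ∅) (by simp)
  obtain ⟨u', w', huw', hu', hw', hne, -⟩ := h.exists_cross_avoid he.symm (X := {u}) (by simp)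
  have hne : u ≠ u' := fun h => hne h.symm
  obtain ⟨C, hdisj, hC⟩ := exists_disjoint_connOn_within G (cell part (part s)) {s, t} {u, u'} 2
    (by rintro v (rfl | rfl); exacts [rfl, hp]) (by
      intro Z hZ X hX hlt hZX hA hcl
      have hsub : cell part (part s) \ X ⊆ Z := (h.conn _ X (by omega)).subset_of_closed (by
        obtain ⟨v, hv, hvX⟩ := Set.exists_mem_notMem_of_ncard_lt_ncard (s := X) (t := {s, t})
          (by rwa [Set.ncard_pair hst]) (Set.toFinite _)
        have hvZ := (hA hv).resolve_right hvX
        exact ⟨v, ⟨hZ hvZ, hvX⟩, hvZ⟩) fun v hv w hw hvw => (hcl v hv w hw.1 hvw).resolve_right hw.2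
      obtain ⟨v, hv, hvX⟩ := Set.exists_mem_notMem_of_ncard_lt_ncard (s := X) (t := {u, u'})
        (by rwa [Set.ncard_pair hne]) (Set.toFinite _)
      exact ⟨v, hsub ⟨by rcases hv with rfl | rfl; exacts [hu, hu'], hvX⟩, hv⟩)
  obtain ⟨k, l, hkl, hsk, htl⟩ : ∃ k l, k ≠ l ∧ s ∈ C k ∧ t ∈ C l := by
    obtain ⟨v₀, hv₀, hv₀'⟩ := (hC 0).2.2.1
    obtain ⟨v₁, hv₁, hv₁'⟩ := (hC 1).2.2.1
    have h01 := Set.disjoint_left.1 (hdisj (show (0 : Fin 2) ≠ 1 by decide))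
    rcases hv₀' with rfl | rfl <;> rcases hv₁' with rfl | rfl
    · exact absurd hv₁ (h01 hv₀)
    · exact ⟨0, 1, by decide, hv₀, hv₁⟩
    · exact ⟨1, 0, by decide, hv₁, hv₀⟩
    · exact absurd hv₁ (h01 hv₀)
  obtain ⟨v₀, hv₀, hv₀'⟩ := (hC k).2.2.2
  obtain ⟨v₁, hv₁, hv₁'⟩ := (hC l).2.2.2
  have h01 := Set.disjoint_left.1 (hdisj hkl)
  rcases hv₀' with rfl | rfl <;> rcases hv₁' with rfl | rfl
  · exact absurd hv₁ (h01 hv₀)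
  · exact ⟨C k, C l, d, e, hdisj hkl, (hC k).1, (hC l).1, (hC k).2.1, (hC l).2.1, hsk, htl,
      Or.inl ⟨rfl, rfl⟩, ⟨_, hv₀, w, huw.1, hw⟩, ⟨_, hv₁, w', huw'.1, hw'⟩⟩
  · exact ⟨C k, C l, e, d, hdisj hkl, (hC k).1, (hC l).1, (hC k).2.1, (hC l).2.1, hsk, htl,
      Or.inr ⟨rfl, rfl⟩, ⟨_, hv₀, w', huw'.1, hw'⟩, ⟨_, hv₁, w, huw.1, hw⟩⟩
  · exact absurd hv₁ (h01 hv₀)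

theorem connOn_cells [Finite V] (h : IsComposed G part m) {J : Set (Fin p)} (hJ : J.Nonempty) :
    ConnOn G (cells part J) := by
  have hm := h.four_le
  simpa using h.connOn_cells_diff hJ (X := ∅) (by simp) (by simp; omega)

theorem connOn_cells_union [Finite V] (h : IsComposed G part m) {a c : Fin p} {N : Set V}
    (hN : ConnOn G N) (hc : ∃ v ∈ N, ∃ w, G.Adj v w ∧ part w = c) :
    ConnOn G (cells part {a, c} ∪ N) := by
  obtain ⟨v, hv, w, hvw, hw⟩ := hc
  exact (h.connOn_cells ⟨a, Or.inl rfl⟩).union hN ⟨w, Or.inr hw, v, hv, Or.inr hvw.symm⟩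

theorem exists_hubPair_of_triangle [Finite V] (h : IsComposed G part m) (hxy : x ≠ y)
    (hp : part y = part x) {x₁ x₂ y₁ y₂ z₁ z₂ : V}
    (hx₁ : OutAdj G part x x₁) (hx₂ : OutAdj G part x x₂) (hy₁ : OutAdj G part y y₁)
    (hy₂ : OutAdj G part y y₂) (hz₁ : OutAdj G part z z₁) (hz₂ : OutAdj G part z z₂)
    (hx : part x₁ ≠ part x₂) (hy : part y₁ ≠ part y₂) (hz : part z₁ ≠ part z₂)
    (hxz₂ : part x₁ = part z₂) (hyx₂ : part y₁ = part x₂) (hzy₂ : part z₁ = part y₂) :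
    ∃ F, IsHubPair G part (part x) x y z F := by
  have hne : y₁ ≠ x₂ := by
    rintro rfl
    exact hxy (h.eq_of_out hx₂ hy₁ hp.symm)
  obtain ⟨d, e, hd, he, hde⟩ : ∃ d e : Fin p, d ∉ ({part x, part x₁, part x₂, part y₂} : Set _) ∧
      e ∉ ({part x, part x₁, part x₂, part y₂} : Set _) ∧ d ≠ e := by
    have h1 := Set.ncard_insert_le (part x) {part x₁, part x₂, part y₂}
    have h2 := Set.ncard_insert_le (part x₁) {part x₂, part y₂}
    have h3 := Set.ncard_insert_le (part x₂) {part y₂}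
    rw [Set.ncard_singleton] at h3
    have h4 := Set.ncard_add_ncard_compl ({part x, part x₁, part x₂, part y₂} : Set (Fin p))
    have := h.seven_le
    rw [Nat.card_fin] at h4
    obtain ⟨d, e, hd, he, hde⟩ := (Set.one_lt_ncard_iff (Set.toFinite
      ({part x, part x₁, part x₂, part y₂}ᶜ : Set (Fin p)))).1 (by omega)
    exact ⟨d, e, hd, he, hde⟩
  simp only [Set.mem_insert_iff, Set.mem_singleton_iff, not_or] at hd he
  obtain ⟨N, N', c, c', hNN, hN, hN', hNb, hNb', hyN, hxN, hcc, hcN, hcN'⟩ :=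
    h.exists_disjoint_exits hne hyx₂.symm (hyx₂ ▸ hd.2.2.1) (hyx₂ ▸ he.2.2.1)
  have hc : c ≠ c' ∧ c ≠ part x ∧ c ≠ part y₂ ∧ c ≠ part y₁ ∧ c' ≠ part x ∧ c' ≠ part x₁ ∧
      c' ≠ part y₁ := by
    rcases hcc with ⟨rfl, rfl⟩ | ⟨rfl, rfl⟩ <;> grind
  have q1 := hx₁.2
  have q2 := hy₁.2
  have q3 := hy₂.2
  have hb : ∀ v ∈ N, part v = part y₁ := fun v hv => hNb hv
  have hb' : ∀ v ∈ N', part v = part y₁ := fun v hv => hNb' hv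
  refine ⟨fun b => bif b then cells part {part x₁, c} ∪ N else cells part {part y₂, c'} ∪ N',
    ?_, ?_, ?_, ?_, ?_, ?_⟩
  · rintro (_ | _)
    · exact h.connOn_cells_union hN' hcN'
    · exact h.connOn_cells_union hN hcN
  · rintro (_ | _) <;> rw [Set.disjoint_left]
    · rintro v ((hv | hv) | hv) (hv' : part v = part x)
      · grind
      · simp only [Set.mem_singleton_iff] at hv; grind
      · grind
    · rintro v ((hv | hv) | hv) (hv' : part v = part x)
      · grind
      · simp only [Set.mem_singleton_iff] at hv; grind
      · grind
  · rw [Set.disjoint_left]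
    rintro v ((hv | hv) | hv) ((hv' | hv') | hv') <;>
      try simp only [Set.mem_singleton_iff] at hv hv'
    all_goals first | exact Set.disjoint_left.1 hNN hv hv' | grind
  · rintro (_ | _)
    · exact ⟨x₂, Or.inr hxN, hx₂.1⟩
    · exact ⟨x₁, Or.inl (Or.inl rfl), hx₁.1⟩
  · rintro (_ | _)
    · exact ⟨y₂, Or.inl (Or.inl rfl), hy₂.1⟩
    · exact ⟨y₁, Or.inr hyN, hy₁.1⟩
  · rintro (_ | _)
    · exact ⟨z₁, Or.inl (Or.inl hzy₂), hz₁.1⟩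
    · exact ⟨z₂, Or.inl (Or.inl hxz₂.symm), hz₂.1⟩

theorem exists_hubPair [Finite V] (h : IsComposed G part m) (hxy : x ≠ y)
    (hp : part y = part x) (hp' : part z = part x) :
    ∃ F, IsHubPair G part (part x) x y z F := by
  have hout : ∀ v, ∃ o : Bool → V, (∀ b, OutAdj G part v (o b)) ∧
      part (o true) ≠ part (o false) := by
    intro v
    obtain ⟨w₁, w₂, h1, h2, h3, -⟩ := h.out v
    exact ⟨fun b => bif b then w₁ else w₂, by rintro (_ | _); exacts [h2, h1], h3⟩
  obtain ⟨a, ha, ha'⟩ := hout x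
  obtain ⟨b, hb, hb'⟩ := hout y
  obtain ⟨c, hc, hc'⟩ := hout z
  rcases exists_orientation (fun s => part (a s)) (fun s => part (b s)) (fun s => part (c s))
    ha' hb' hc' with ⟨s, t, u, hstu⟩ | ⟨s, t, u, h1, h2, h3⟩
  · have hoff : ∀ s t u, Disjoint (cells part {part (a s), part (b t), part (c u)})
        (cell part (part x)) := by
      intro s t u
      rw [Set.disjoint_left]
      rintro v (hv | hv | hv) (hv' : part v = part x)
      · exact (ha s).2 (hv.symm.trans hv')
      · exact (hb t).2 (hv.symm.trans (hv'.trans hp.symm))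
      · exact (hc u).2 ((show part v = part (c u) from hv).symm.trans (hv'.trans hp'.symm))
    refine ⟨fun r => bif r then cells part {part (a s), part (b t), part (c u)} else
      cells part {part (a !s), part (b !t), part (c !u)}, ?_, ?_, ?_, ?_, ?_, ?_⟩
    · rintro (_ | _) <;> exact h.connOn_cells ⟨_, Or.inl rfl⟩
    · rintro (_ | _) <;> exact hoff _ _ _
    · exact Set.disjoint_left.2 fun v hv => hstu _ hv
    · rintro (_ | _)
      exacts [⟨_, Or.inl rfl, (ha _).1⟩, ⟨_, Or.inl rfl, (ha _).1⟩]
    · rintro (_ | _)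
      exacts [⟨_, Or.inr (Or.inl rfl), (hb _).1⟩, ⟨_, Or.inr (Or.inl rfl), (hb _).1⟩]
    · rintro (_ | _)
      exacts [⟨_, Or.inr (Or.inr rfl), (hc _).1⟩, ⟨_, Or.inr (Or.inr rfl), (hc _).1⟩]
  · have hne : ∀ {o : Bool → V}, part (o true) ≠ part (o false) → ∀ s, part (o s) ≠ part (o !s) := by
      rintro o ho (_ | _)
      exacts [ho.symm, ho]
    exact h.exists_hubPair_of_triangle hxy hp (ha s) (ha !s) (hb t) (hb !t) (hc u) (hc !u)
      (hne ha' s) (hne hb' t) (hne hc' u) h1 h2 h3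

end IsComposed

theorem IsHubPair.connectsSet {V : Type*} [Finite V] {p n : ℕ} {G : SimpleGraph V}
    {part : V → Fin p} {i : Fin p} {x y z : V} {F : Bool → Set V}
    (hF : IsHubPair G part i x y z F) (hS : {x, y, z} ⊆ cell part i) (T : Fin n → G.Subgraph)
    (hTD : ∀ a, (T a).verts ⊆ cell part i) (hT : ∀ a, (T a).coe.IsTree)
    (hTS : ∀ a, {x, y, z} ⊆ (T a).verts)
    (hTi : ∀ a b, a ≠ b → (T a).verts ∩ (T b).verts = {x, y, z})
    (hTe : ∀ a b, a ≠ b → Disjoint (T a).edgeSet (T b).edgeSet) :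
    ConnectsSet G {x, y, z} (n + 2) := by
  have hoff : ∀ b, Disjoint (F b) {x, y, z} := fun b => (hF.off b).mono_right hS
  exact connectsSet_of_trees_of_hubs T hTD hT hTS hTi hTe F (fun b =>
    ((hF.conn b).edgesOff (hoff b)).union_triple ((hF.left b).edgesOff (hoff b))
      ((hF.mid b).edgesOff (hoff b)) ((hF.right b).edgesOff (hoff b))) hF.off hF.disj

theorem ConnOn.image_val {V : Type*} {G : SimpleGraph V} {s : Set V} {Y : Set s}
    (hY : ConnOn (G.induce s) Y) : ConnOn G (Subtype.val '' Y) := by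
  refine ⟨hY.1.image _, fun Z hZ hne hcl => ?_⟩
  have hsub : Y ⊆ Subtype.val ⁻¹' Z := by
    refine (hY.2 (Y ∩ Subtype.val ⁻¹' Z) Set.inter_subset_left ?_ ?_).trans Set.inter_subset_right
    · obtain ⟨v, hv⟩ := hne
      obtain ⟨u, hu, rfl⟩ := hZ hv
      exact ⟨u, hu, hv⟩
    · exact fun v hv w hw hvw => ⟨hw, hcl v hv.2 w ⟨w, hw, rfl⟩ hvw⟩
  rintro _ ⟨v, hv, rfl⟩
  exact hsub hv

/-- with the partitioned-graph set-up (`p ≥ 7` parts), if `G` is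
`(m+2)`-regular and `(m+2)`-connected, any two vertices in different parts have at most one
common outside neighbour, and every 3-set inside a part is connected by `m - 1` internally
disjoint trees of that part, then `κ₃(G) ≥ m + 1`. -/
theorem stmt_4 {V : Type*} [Fintype V] (G : SimpleGraph V)
    (p q m : ℕ) (hm : 4 ≤ m) (hp : 7 ≤ p)
    (hGreg : ∀ v : V, (G.neighborSet v).ncard = m + 2)
    (hGconn : IsKConnected (m + 2) G)
    (part : V → Fin p)
    (hsize : ∀ i : Fin p, {v : V | part v = i}.ncard = q)
    (hreg : ∀ v : V, {w : V | G.Adj v w ∧ part w = part v}.ncard = m)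
    (hconn : ∀ i : Fin p, IsKConnected m (G.induce {v : V | part v = i}))
    (hout : ∀ v : V, ∃ w₁ w₂ : V, w₁ ≠ w₂ ∧ G.Adj v w₁ ∧ G.Adj v w₂ ∧
      part w₁ ≠ part v ∧ part w₂ ≠ part v ∧ part w₁ ≠ part w₂ ∧
      (∀ w : V, G.Adj v w → part w ≠ part v → w = w₁ ∨ w = w₂))
    (hcross : ∀ i j : Fin p, i ≠ j →
      {e : V × V | G.Adj e.1 e.2 ∧ part e.1 = i ∧ part e.2 = j}.ncard * (p - 1) = 2 * q ∧
      m + 2 ≤ {e : V × V | G.Adj e.1 e.2 ∧ part e.1 = i ∧ part e.2 = j}.ncard)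
    (hcommon : ∀ u v : V, part u ≠ part v →
      {w : V | G.Adj u w ∧ part w ≠ part u ∧ G.Adj v w ∧ part w ≠ part v}.ncard ≤ 1)
    (htrees : ∀ i : Fin p, ∀ S : Set V, S ⊆ {v : V | part v = i} → S.ncard = 3 →
      ∃ T : Fin (m - 1) → G.Subgraph,
        (∀ a, (T a).verts ⊆ {v : V | part v = i}) ∧
        (∀ a, (T a).coe.IsTree) ∧
        (∀ a, S ⊆ (T a).verts) ∧
        (∀ a b, a ≠ b → (T a).verts ∩ (T b).verts = S) ∧
        (∀ a b, a ≠ b → Disjoint (T a).edgeSet (T b).edgeSet)) :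
    m + 1 ≤ kappa3 G := by
  have h : IsComposed G part m :=
    { four_le := hm
      seven_le := hp
      inner := hreg
      conn := fun i X hX => by
        have hD : (Subtype.val ⁻¹' X : Set {v : V | part v = i}).ncard < m := by
          rw [← Set.ncard_image_of_injective _ Subtype.val_injective]
          exact (Set.ncard_le_ncard (Set.image_preimage_subset _ _) (Set.toFinite _)).trans_lt hX
        have := (connOn_iff_induce_connected.2 ((hconn i).2 _ hD)).image_val
        convert this using 1
        ext v
        simp [cell]
      out := fun v => by
        obtain ⟨w₁, w₂, -, h1, h2, h3, h4, h5, h6⟩ := hout v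
        exact ⟨w₁, w₂, ⟨h1, h3⟩, ⟨h2, h4⟩, h5, fun w hw => h6 w hw.1 hw.2⟩
      cross := fun i j hij => (hcross i j hij).2 }
  refine le_kappa3_of_forall_connectsSet (by have := hGconn.1; omega) fun S hS => ?_
  obtain ⟨x, y, z, hxy, hxz, hyz, rfl⟩ := Set.ncard_eq_three.1 hS
  have hperm : ({y, z, x} : Set V) = {x, y, z} := by grind
  have hperm' : ({x, z, y} : Set V) = {x, y, z} := by grind
  by_cases hyx : part y = part x
  · by_cases hzx : part z = part x
    · have hsub : {x, y, z} ⊆ cell part (part x) := by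
        rintro v (rfl | rfl | rfl)
        exacts [rfl, hyx, hzx]
      obtain ⟨T, hTD, hT, hTS, hTi, hTe⟩ := htrees (part x) _ hsub hS
      obtain ⟨F, hF⟩ := h.exists_hubPair hxy hyx hzx
      have := hF.connectsSet hsub T hTD hT hTS hTi hTe
      rwa [show m - 1 + 2 = m + 1 by omega] at this
    · exact h.connectsSet_two_one hxy hyx hzx
  · by_cases hzx : part z = part x
    · exact hperm' ▸ h.connectsSet_two_one hxz hzx hyx
    · by_cases hzy : part z = part y
      · exact hperm ▸ h.connectsSet_two_one hyz hzy (Ne.symm hyx)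
      · exact h.connectsSet_three_parts (Ne.symm hyx) (Ne.symm hzx) (Ne.symm hzy)
end
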